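/- Let k ≥ 4 and let d_1 > d_2 > … > d_{k−2} ≥ d_{k−1} be positive integers with d_{k−1} ≥ k − 1. Set n = Σ_{i=1}^{k−1}(2^{d_i} − 1) and m = Σ_{i=1}^{k−2}(2^{d_i − d_{k−1}} − 1). Then dim_{F_2}(QP_k)_n = (2^k − 1) · dim_{F_2}(QP_{k−1})_m. -/

import Mathlib

open MvPolynomial

/-- The total Steenrod square on `P_k = F_2[x_1,…,x_k]`, the algebra map with
`Sq(x_j) = x_j + x_j^2`. -/
noncomputable def SqTotal (k : ℕ) :
    MvPolynomial (Fin k) (ZMod 2) →ₐ[ZMod 2] MvPolynomial (Fin k) (ZMod 2) :=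
  aeval fun j => X j + X j ^ 2

/-- The Steenrod square `Sq^i : P_k → P_k`, sending a homogeneous polynomial `f` of
degree `d` to the degree-`d + i` homogeneous component of `Sq(f)`, extended additively. -/
noncomputable def SqOp (k i : ℕ) (f : MvPolynomial (Fin k) (ZMod 2)) :
    MvPolynomial (Fin k) (ZMod 2) :=
  ∑ d ∈ Finset.range (f.totalDegree + 1),
    homogeneousComponent (d + i) (SqTotal k (homogeneousComponent d f))

/-- The space of hit polynomials: finite sums of `Sq^i (f_i)` with `i > 0`. -/
noncomputable def hitSubmodule (k : ℕ) :
    Submodule (ZMod 2) (MvPolynomial (Fin k) (ZMod 2)) :=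
  Submodule.span (ZMod 2) {g | ∃ i f, 0 < i ∧ g = SqOp k i f}

/-- A polynomial is hit if it is a finite sum of `Sq^i (f_i)` with `i > 0`. -/
def IsHit (k : ℕ) (f : MvPolynomial (Fin k) (ZMod 2)) : Prop := f ∈ hitSubmodule k

/-- `(QP_k)_n`: the space of homogeneous polynomials of degree `n` modulo hit polynomials. -/
abbrev QP (k n : ℕ) :=
  ↥(homogeneousSubmodule (Fin k) (ZMod 2) n) ⧸
    ((hitSubmodule k).comap (homogeneousSubmodule (Fin k) (ZMod 2) n).subtype)

/-- Every monomial of `f` has its degree in `A`. -/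
def DegreesIn {k : ℕ} (A : Set ℕ) (f : MvPolynomial (Fin k) (ZMod 2)) : Prop :=
  ∀ e, coeff e f ≠ 0 → e.degree ∈ A

namespace DegreesIn

variable {k : ℕ} {A B C : Set ℕ} {f g : MvPolynomial (Fin k) (ZMod 2)}

lemma mono (h : DegreesIn A f) (hAB : A ⊆ B) : DegreesIn B f := fun e he => hAB (h e he)

lemma add (hf : DegreesIn A f) (hg : DegreesIn A g) : DegreesIn A (f + g) := by
  intro e he
  by_cases h : coeff e f = 0
  · refine hg e fun h' => he ?_
    rw [coeff_add, h, h', add_zero]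
  · exact hf e h

lemma sum {ι : Type*} (s : Finset ι) (F : ι → MvPolynomial (Fin k) (ZMod 2))
    (h : ∀ i ∈ s, DegreesIn A (F i)) : DegreesIn A (∑ i ∈ s, F i) := by
  classical
  induction s using Finset.induction_on with
  | empty => intro e he; simp at he
  | insert a s ha ih =>
    rw [Finset.sum_insert ha]
    exact add (h a (by simp)) (ih fun i hi => h i (by simp [hi]))

lemma mul (hf : DegreesIn A f) (hg : DegreesIn B g)
    (hC : ∀ a ∈ A, ∀ b ∈ B, a + b ∈ C) : DegreesIn C (f * g) := by
  classical
  intro e he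
  rw [coeff_mul] at he
  obtain ⟨⟨a, b⟩, hab, hne⟩ := Finset.exists_ne_zero_of_sum_ne_zero he
  rw [Finset.HasAntidiagonal.mem_antidiagonal] at hab
  rw [← hab, map_add]
  exact hC _ (hf a (left_ne_zero_of_mul hne)) _ (hg b (right_ne_zero_of_mul hne))

lemma monomial (e : Fin k →₀ ℕ) : DegreesIn {e.degree} (monomial e (1 : ZMod 2)) := by
  classical
  intro e' he
  rw [coeff_monomial] at he
  have : e = e' := by by_contra h; simp [h] at he
  simp [this]

lemma X_pow (j : Fin k) (a : ℕ) :
    DegreesIn {a} (X j ^ a : MvPolynomial (Fin k) (ZMod 2)) := by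
  rw [X_pow_eq_monomial]
  simpa using monomial (Finsupp.single j a)

lemma of_isHomogeneous {q : ℕ} (h : f.IsHomogeneous q) : DegreesIn {q} f := by
  intro e he
  rw [Finsupp.degree_eq_weight_one]
  exact h he

end DegreesIn

section SteenrodSquare

variable {k : ℕ}

@[simp] lemma SqTotal_X (j : Fin k) : SqTotal k (X j) = X j + X j ^ 2 := by simp [SqTotal]

lemma monomial_add_single_one (e : Fin k →₀ ℕ) (j : Fin k) :
    monomial (e + Finsupp.single j 1) (1 : ZMod 2) = X j * monomial e 1 := by
  rw [monomial_add_single, pow_one, mul_comm]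

lemma exists_eq_add_single {e : Fin k →₀ ℕ} (he : e ≠ 0) :
    ∃ e' j, e = e' + Finsupp.single j 1 := by
  obtain ⟨j, hj⟩ := Finsupp.ne_iff.mp he
  refine ⟨e - Finsupp.single j 1, j, (tsub_add_cancel_of_le ?_).symm⟩
  rw [Finsupp.single_le_iff]
  exact Nat.one_le_iff_ne_zero.mpr hj

lemma monomial_degree_induction {P : (Fin k →₀ ℕ) → Prop} (zero : P 0)
    (add : ∀ e j, P e → P (e + Finsupp.single j 1)) (e : Fin k →₀ ℕ) : P e := by
  induction h : e.degree using Nat.strong_induction_on generalizing e with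
  | _ n ih =>
    by_cases he : e = 0
    · exact he ▸ zero
    · obtain ⟨e', j, rfl⟩ := exists_eq_add_single he
      refine add e' j (ih e'.degree ?_ e' rfl)
      rw [← h, map_add, Finsupp.degree_single]
      exact Nat.lt_succ_self _

lemma SqTotal_monomial_degreesIn (e : Fin k →₀ ℕ) :
    DegreesIn {m | e.degree < m} (SqTotal k (monomial e 1) - monomial e 1) ∧
      DegreesIn {m | m < 2 * e.degree} (SqTotal k (monomial e 1) - monomial e 1 ^ 2) ∧
      DegreesIn {m | e.degree ≤ m ∧ m ≤ 2 * e.degree} (SqTotal k (monomial e 1)) := by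
  induction e using monomial_degree_induction with
  | zero =>
    have h1 : monomial (0 : Fin k →₀ ℕ) (1 : ZMod 2) = 1 := rfl
    refine ⟨fun e he => ?_, fun e he => ?_, ?_⟩
    · simp [h1] at he
    · simp [h1] at he
    · rw [h1, map_one, ← h1]
      exact (DegreesIn.monomial 0).mono (by simp)
  | add e j ih =>
    obtain ⟨h1, h2, h3⟩ := ih
    have hX : DegreesIn {1} (X j : MvPolynomial (Fin k) (ZMod 2)) := by
      simpa using DegreesIn.X_pow j 1
    have hX2 := DegreesIn.X_pow j 2
    rw [monomial_add_single_one, map_mul, SqTotal_X, map_add, Finsupp.degree_single]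
    refine ⟨?_, ?_, ?_⟩
    · rw [show ∀ S m x : MvPolynomial (Fin k) (ZMod 2),
        (x + x ^ 2) * S - x * m = (S - m) * x + S * x ^ 2 by intros; ring]
      refine (h1.mul hX ?_).add (h3.mul hX2 ?_) <;> simp
      omega
    · rw [show ∀ S m x : MvPolynomial (Fin k) (ZMod 2),
        (x + x ^ 2) * S - (x * m) ^ 2 = S * x + (S - m ^ 2) * x ^ 2 by intros; ring]
      refine (h3.mul hX ?_).add (h2.mul hX2 ?_) <;> simp <;> omega
    · rw [show ∀ S x : MvPolynomial (Fin k) (ZMod 2),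
        (x + x ^ 2) * S = S * x + S * x ^ 2 by intros; ring]
      refine (h3.mul hX ?_).add (h3.mul hX2 ?_) <;> simp <;> omega

end SteenrodSquare

/-- The polynomial algebra `P_k`. -/
abbrev F2Poly (k : ℕ) := MvPolynomial (Fin k) (ZMod 2)

section Raise

variable {k : ℕ}

/-- The product of the variables indexed by `J`. -/
noncomputable def varProd (J : Finset (Fin k)) : F2Poly k := ∏ j ∈ J, X j

/-- The map `y ↦ (∏ j ∈ J, x_j) * y ^ 2`, which is linear in characteristic two. -/
noncomputable def raise (J : Finset (Fin k)) : F2Poly k →ₗ[ZMod 2] F2Poly k where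
  toFun y := varProd J * y ^ 2
  map_add' x y := by rw [CharTwo.add_sq, mul_add]
  map_smul' c x := by
    have : c ^ 2 = c := ZMod.pow_card c
    rw [smul_pow, this, mul_smul_comm, RingHom.id_apply]

lemma raise_apply (J : Finset (Fin k)) (y : F2Poly k) : raise J y = varProd J * y ^ 2 := rfl

lemma SqTotal_raise (J : Finset (Fin k)) (y : F2Poly k) :
    SqTotal k (raise J y) =
      ∑ I ∈ J.powerset, raise I (varProd (J \ I) * SqTotal k y) := by
  simp only [raise_apply, varProd, map_mul, map_prod, map_pow, SqTotal_X, Finset.prod_add,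
    Finset.sum_mul, mul_pow, Finset.prod_pow]
  exact Finset.sum_congr rfl fun I _ => by ring

lemma X_mul_raise_of_mem {J : Finset (Fin k)} {j : Fin k} (hj : j ∈ J) (y : F2Poly k) :
    X j * raise J y = raise (J.erase j) (X j * y) := by
  simp only [raise_apply, varProd, ← Finset.mul_prod_erase J _ hj]
  ring

lemma X_mul_raise_of_notMem {J : Finset (Fin k)} {j : Fin k} (hj : j ∉ J) (y : F2Poly k) :
    X j * raise J y = raise (insert j J) y := by
  simp only [raise_apply, varProd, Finset.prod_insert hj]
  ring

/-- The exponent vector of `∏ j ∈ J, x_j`. -/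
noncomputable def indicatorExp (J : Finset (Fin k)) : Fin k →₀ ℕ :=
  Finsupp.equivFunOnFinite.symm fun j => if j ∈ J then 1 else 0

lemma indicatorExp_apply (J : Finset (Fin k)) (j : Fin k) :
    indicatorExp J j = if j ∈ J then 1 else 0 := rfl

lemma varProd_eq_monomial (J : Finset (Fin k)) : varProd J = monomial (indicatorExp J) 1 := by
  rw [monomial_eq, C_1, one_mul, Finsupp.prod_fintype _ _ (by simp)]
  simp [indicatorExp_apply, varProd, Finset.prod_ite_mem]

lemma raise_monomial (J : Finset (Fin k)) (e : Fin k →₀ ℕ) :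
    raise J (monomial e 1) = monomial (indicatorExp J + 2 • e) 1 := by
  rw [raise_apply, varProd_eq_monomial, monomial_pow, monomial_mul, one_pow, one_mul]

/-- The variables occurring with odd exponent. -/
def oddPart (e : Fin k →₀ ℕ) : Finset (Fin k) := Finset.univ.filter fun j => e j % 2 = 1

/-- The exponents halved, rounding down. -/
noncomputable def halfExp (e : Fin k →₀ ℕ) : Fin k →₀ ℕ :=
  Finsupp.equivFunOnFinite.symm fun j => e j / 2

lemma indicatorExp_oddPart_add (e : Fin k →₀ ℕ) :
    indicatorExp (oddPart e) + 2 • halfExp e = e := by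
  ext j
  simp only [Finsupp.add_apply, Finsupp.smul_apply, indicatorExp_apply, oddPart, halfExp,
    Finsupp.equivFunOnFinite_symm_apply_apply, Finset.mem_filter, Finset.mem_univ, true_and,
    smul_eq_mul]
  split_ifs <;> omega

lemma oddPart_indicatorExp_add (J : Finset (Fin k)) (e : Fin k →₀ ℕ) :
    oddPart (indicatorExp J + 2 • e) = J := by
  ext j
  rw [oddPart, Finset.mem_filter_univ, Finsupp.add_apply, Finsupp.smul_apply,
    indicatorExp_apply, smul_eq_mul]
  by_cases hj : j ∈ J <;> simp [hj, Nat.add_mul_mod_self_left]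

lemma halfExp_indicatorExp_add (J : Finset (Fin k)) (e : Fin k →₀ ℕ) :
    halfExp (indicatorExp J + 2 • e) = e := by
  ext j
  simp only [halfExp, Finsupp.equivFunOnFinite_symm_apply_apply, Finsupp.add_apply,
    Finsupp.smul_apply, indicatorExp_apply, smul_eq_mul]
  split_ifs <;> omega

lemma linearMap_ext_monomial {M : Type*} [AddCommGroup M] [Module (ZMod 2) M]
    {f g : F2Poly k →ₗ[ZMod 2] M} (h : ∀ e, f (monomial e 1) = g (monomial e 1)) : f = g :=
  (basisMonomials (Fin k) (ZMod 2)).ext fun e => by simpa using h e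

lemma linearMap_ext_raise {M : Type*} [AddCommGroup M] [Module (ZMod 2) M]
    {f g : F2Poly k →ₗ[ZMod 2] M} (h : ∀ J, f ∘ₗ raise J = g ∘ₗ raise J) : f = g :=
  linearMap_ext_monomial fun e => by
    have := LinearMap.congr_fun (h (oddPart e)) (monomial (halfExp e) 1)
    simpa only [LinearMap.comp_apply, raise_monomial, indicatorExp_oddPart_add] using this

/-- The left inverse of `raise J` which vanishes on the image of `raise I` for `I ≠ J`. -/
noncomputable def lower (J : Finset (Fin k)) : F2Poly k →ₗ[ZMod 2] F2Poly k :=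
  (basisMonomials (Fin k) (ZMod 2)).constr (ZMod 2) fun e =>
    if oddPart e = J then monomial (halfExp e) 1 else 0

lemma lower_monomial (J : Finset (Fin k)) (e : Fin k →₀ ℕ) :
    lower J (monomial e 1) = if oddPart e = J then monomial (halfExp e) 1 else 0 := by
  have := (basisMonomials (Fin k) (ZMod 2)).constr_basis (ZMod 2) (fun e =>
    if oddPart e = J then (monomial (halfExp e) 1 : F2Poly k) else 0) e
  simpa [lower] using this

lemma lower_raise (I J : Finset (Fin k)) (y : F2Poly k) :
    lower J (raise I y) = if I = J then y else 0 := by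
  have : lower J ∘ₗ raise I = if I = J then LinearMap.id else 0 := by
    refine linearMap_ext_monomial fun e => ?_
    rw [LinearMap.comp_apply, raise_monomial, lower_monomial, oddPart_indicatorExp_add,
      halfExp_indicatorExp_add]
    split_ifs <;> simp
  rw [← LinearMap.comp_apply, this]
  split_ifs <;> simp

lemma raise_monomial_degree (J : Finset (Fin k)) (e : Fin k →₀ ℕ) :
    (indicatorExp J + 2 • e).degree = J.card + 2 * e.degree := by
  rw [map_add, map_nsmul, smul_eq_mul]
  congr 1
  rw [Finsupp.degree_eq_sum]
  simp [indicatorExp_apply]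

end Raise

section Annihilators

variable {k : ℕ}

/-- The linear functionals on `P_k` concentrated in degree `n` which vanish on hit polynomials. -/
def hitAnnihilator (k n : ℕ) : Submodule (ZMod 2) (Module.Dual (ZMod 2) (F2Poly k)) where
  carrier := {φ | φ ∘ₗ (SqTotal k).toLinearMap = φ ∧ ∀ e, e.degree ≠ n → φ (monomial e 1) = 0}
  add_mem' := by
    rintro φ ψ ⟨h1, h2⟩ ⟨h3, h4⟩
    refine ⟨by rw [LinearMap.add_comp, h1, h3], fun e he => ?_⟩
    rw [LinearMap.add_apply, h2 e he, h4 e he, add_zero]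
  zero_mem' := ⟨by simp, by simp⟩
  smul_mem' := by
    rintro c φ ⟨h1, h2⟩
    refine ⟨by rw [LinearMap.smul_comp, h1], fun e he => ?_⟩
    rw [LinearMap.smul_apply, h2 e he, smul_zero]

variable {n : ℕ} {φ : Module.Dual (ZMod 2) (F2Poly k)}

lemma apply_SqTotal (h : φ ∈ hitAnnihilator k n) (f : F2Poly k) : φ (SqTotal k f) = φ f :=
  LinearMap.congr_fun h.1 f

lemma apply_eq_zero_of_degreesIn (h : ∀ e, e.degree ≠ n → φ (monomial e 1) = 0) {A : Set ℕ}
    {f : F2Poly k} (hf : DegreesIn A f) (hn : n ∉ A) : φ f = 0 := by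
  rw [f.as_sum, map_sum]
  refine Finset.sum_eq_zero fun e he => ?_
  rw [mem_support_iff] at he
  rw [show monomial e (coeff e f) = coeff e f • monomial e (1 : ZMod 2) by
    rw [smul_monomial, smul_eq_mul, mul_one], map_smul, h e, smul_zero]
  rintro rfl
  exact hn (hf e he)

/-- A functional concentrated in one degree which vanishes on the image of the total square
is zero. -/
lemma eq_zero_of_comp_SqTotal {c : ℕ} (h : ∀ e, e.degree + c ≠ n → φ (monomial e 1) = 0)
    (hSq : ∀ f, φ (SqTotal k f) = 0) : φ = 0 := by
  refine linearMap_ext_monomial fun e => ?_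
  by_cases he : e.degree + c = n
  · have h' : ∀ e' : Fin k →₀ ℕ, e'.degree ≠ e.degree → φ (monomial e' 1) = 0 :=
      fun e' he' => h e' (by omega)
    have := apply_eq_zero_of_degreesIn h' (SqTotal_monomial_degreesIn e).1 (by simp)
    rw [map_sub, hSq, zero_sub, neg_eq_zero] at this
    rw [this, LinearMap.zero_apply]
  · rw [h e he, LinearMap.zero_apply]

end Annihilators

section Vanishing

variable {k n : ℕ} {φ : Module.Dual (ZMod 2) (F2Poly k)}

lemma SqTotal_sum_X_pow_two_pow (j : Fin k) (N : ℕ) :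
    SqTotal k (∑ a ∈ Finset.range N, X j ^ 2 ^ a) = X j + X j ^ 2 ^ N := by
  induction N with
  | zero => simp [CharTwo.add_self_eq_zero]
  | succ N ih =>
    rw [Finset.sum_range_succ, map_add, ih, map_pow, SqTotal_X, add_pow_char_pow, ← pow_mul,
      ← pow_succ', ← add_assoc, add_assoc (X j), CharTwo.add_self_eq_zero, add_zero]

lemma prod_sum_X_pow_degreesIn (J : Finset (Fin k)) (s : Finset ℕ) :
    DegreesIn {m | ∃ a : Fin k → ℕ, m = ∑ j ∈ J, 2 ^ a j}
      (∏ j ∈ J, ∑ a ∈ s, (X j : F2Poly k) ^ 2 ^ a) := by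
  induction J using Finset.induction_on with
  | empty => exact (DegreesIn.monomial 0).mono (by simp)
  | insert i J hi ih =>
    rw [Finset.prod_insert hi]
    have : DegreesIn {m | ∃ a, m = 2 ^ a} (∑ a ∈ s, (X i : F2Poly k) ^ 2 ^ a) :=
      DegreesIn.sum _ _ fun a _ => (DegreesIn.X_pow i _).mono (by simp)
    refine this.mul ih ?_
    rintro _ ⟨a, rfl⟩ _ ⟨b, rfl⟩
    refine ⟨Function.update b i a, ?_⟩
    rw [Finset.sum_insert hi, Function.update_self]
    congr 1
    refine Finset.sum_congr rfl fun j hj => ?_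
    rw [Function.update_of_ne (ne_of_mem_of_not_mem hj hi)]

lemma degreesIn_univ (f : F2Poly k) : DegreesIn Set.univ f := fun _ _ => trivial

lemma prod_X_add_X_pow_degreesIn (J : Finset (Fin k)) {N : ℕ} (hN : n < N) :
    DegreesIn {m | n < m} (∏ j ∈ J, ((X j : F2Poly k) + X j ^ N) - varProd J) := by
  induction J using Finset.induction_on with
  | empty => intro e he; simp [varProd] at he
  | insert i J hi ih =>
    rw [Finset.prod_insert hi, varProd, Finset.prod_insert hi, ← varProd,
      show ∀ x y p v : F2Poly k, (x + y) * p - x * v = x * (p - v) + y * p by intros; ring]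
    refine ((degreesIn_univ _).mul ih ?_).add ((DegreesIn.X_pow i N).mul (degreesIn_univ _) ?_)
    · intro a _ b hb
      exact lt_of_lt_of_le hb (Nat.le_add_left _ _)
    · rintro _ rfl b _
      exact lt_of_lt_of_le hN (Nat.le_add_right _ _)

/-- A functional vanishing on hit polynomials vanishes on `(∏ j ∈ J, x_j) * y ^ 2` unless
`n + |J|` is a sum of `|J|` powers of two, each at least two. -/
lemma comp_raise_eq_zero (hφ : φ ∈ hitAnnihilator k n) {J : Finset (Fin k)}
    (hJ : ∀ a : Fin k → ℕ, n + J.card ≠ ∑ j ∈ J, 2 ^ (a j + 1)) : φ ∘ₗ raise J = 0 := by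
  refine linearMap_ext_monomial fun e => ?_
  rw [LinearMap.comp_apply, LinearMap.zero_apply]
  by_cases hn : J.card + 2 * e.degree = n
  swap
  · rw [raise_monomial, hφ.2]
    rwa [raise_monomial_degree]
  set y : F2Poly k := monomial e 1
  set T : F2Poly k := ∏ j ∈ J, ∑ a ∈ Finset.range n, X j ^ 2 ^ a
  have hT : φ (T * y) = 0 := by
    refine apply_eq_zero_of_degreesIn hφ.2
      (A := {m | ∃ a : Fin k → ℕ, m = ∑ j ∈ J, 2 ^ a j + e.degree})
      ((prod_sum_X_pow_degreesIn J _).mul (DegreesIn.monomial e) ?_) ?_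
    · rintro _ ⟨a, rfl⟩ _ rfl
      exact ⟨a, rfl⟩
    · rintro ⟨a, ha⟩
      refine hJ a ?_
      simp only [pow_succ, ← Finset.sum_mul]
      omega
  have hS : SqTotal k T = ∏ j ∈ J, (X j + X j ^ 2 ^ n) := by
    simp only [T, map_prod, SqTotal_sum_X_pow_two_pow]
  have h1 : φ ((∏ j ∈ J, (X j + X j ^ 2 ^ n) - varProd J) * SqTotal k y) = 0 := by
    refine apply_eq_zero_of_degreesIn hφ.2 (A := {m | n < m})
      ((prod_X_add_X_pow_degreesIn J n.lt_two_pow_self).mul (degreesIn_univ _) ?_) (by simp)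
    intro a ha b _
    exact lt_of_lt_of_le ha (Nat.le_add_right _ _)
  have h2 : φ (varProd J * (SqTotal k y - y ^ 2)) = 0 := by
    rw [varProd_eq_monomial]
    refine apply_eq_zero_of_degreesIn hφ.2 (A := {m | m < n})
      ((DegreesIn.monomial _).mul (SqTotal_monomial_degreesIn e).2.1 ?_) (by simp)
    rintro _ rfl b hb
    have := raise_monomial_degree J 0
    simp only [smul_zero, add_zero, map_zero, mul_zero] at this
    simp only [Set.mem_ofPred_eq] at hb ⊢
    omega
  rw [← apply_SqTotal hφ, map_mul, hS] at hT
  rw [sub_mul, map_sub, hT, zero_sub, neg_eq_zero] at h1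
  rw [mul_sub, map_sub, h1, zero_sub, neg_eq_zero] at h2
  exact h2

end Vanishing

section BinaryExpansion

lemma exists_sum_two_pow_add (B : Finset ℕ) (a : ℕ) :
    ∃ B' : Finset ℕ, ∑ b ∈ B', 2 ^ b = ∑ b ∈ B, 2 ^ b + 2 ^ a ∧ B'.card ≤ B.card + 1 := by
  induction h : B.card generalizing B a with
  | zero =>
    rw [Finset.card_eq_zero] at h
    exact ⟨{a}, by simp [h]⟩
  | succ s ih =>
    by_cases ha : a ∈ B
    · obtain ⟨B', h1, h2⟩ := ih (B.erase a) (a + 1) (by rw [Finset.card_erase_of_mem ha]; omega)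
      refine ⟨B', ?_, by omega⟩
      rw [h1, ← Finset.sum_erase_add B _ ha, pow_succ]
      ring
    · exact ⟨insert a B, by rw [Finset.sum_insert ha, add_comm],
        by rw [Finset.card_insert_of_notMem ha, h]⟩

lemma exists_sum_two_pow_eq {ι : Type*} (J : Finset ι) (a : ι → ℕ) :
    ∃ B : Finset ℕ, ∑ b ∈ B, 2 ^ b = ∑ j ∈ J, 2 ^ a j ∧ B.card ≤ J.card := by
  classical
  induction J using Finset.induction_on with
  | empty => exact ⟨∅, by simp⟩
  | insert i J hi ih =>
    obtain ⟨B, h1, h2⟩ := ih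
    obtain ⟨B', h3, h4⟩ := exists_sum_two_pow_add B (a i)
    refine ⟨B', ?_, ?_⟩
    · rw [h3, h1, Finset.sum_insert hi, add_comm]
    · rw [Finset.card_insert_of_notMem hi]
      omega

/-- A sum of distinct powers of two is not a sum of fewer powers of two. -/
lemma card_le_of_sum_two_pow_eq {ι : Type*} {B : Finset ℕ} {J : Finset ι} {a : ι → ℕ}
    (h : ∑ b ∈ B, 2 ^ b = ∑ j ∈ J, 2 ^ a j) : B.card ≤ J.card := by
  obtain ⟨B', h1, h2⟩ := exists_sum_two_pow_eq J a
  rwa [Finset.geomSum_injective le_rfl (h1.trans h.symm)] at h2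

/-- For `c 1 > ⋯ > c s ≥ c (s + 1) ≥ 1`, adding `t ≤ s` to `∑ (2 ^ c i - 1)` does not yield
a sum of `t` powers of two. -/
lemma sum_two_pow_sub_one_add_ne {s t : ℕ} {c : ℕ → ℕ}
    (hinj : Set.InjOn c (Finset.Icc 1 s)) (hle : ∀ i ∈ Finset.Icc 1 s, c (s + 1) ≤ c i)
    (hpos : 1 ≤ c (s + 1)) (ht : t ≤ s) {ι : Type*} {J : Finset ι} (hJ : J.card = t)
    (a : ι → ℕ) : ∑ i ∈ Finset.Icc 1 (s + 1), (2 ^ c i - 1) + t ≠ ∑ j ∈ J, 2 ^ a j := by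
  intro h
  have h1 : ∑ i ∈ Finset.Icc 1 s, (2 ^ c i - 1) + s = ∑ i ∈ Finset.Icc 1 s, 2 ^ c i := by
    have : ∑ i ∈ Finset.Icc 1 s, (2 ^ c i - 1 + 1) = ∑ i ∈ Finset.Icc 1 s, 2 ^ c i :=
      Finset.sum_congr rfl fun i _ => Nat.sub_add_cancel Nat.one_le_two_pow
    rw [← this, Finset.sum_add_distrib]
    simp
  have h2 : ∑ b ∈ Finset.range (c (s + 1)), 2 ^ b = 2 ^ c (s + 1) - 1 :=
    Nat.geomSum_eq le_rfl _ |>.trans (by simp)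
  have hdisj : Disjoint ((Finset.Icc 1 s).image c) (Finset.range (c (s + 1))) := by
    rw [Finset.disjoint_left]
    intro b hb
    obtain ⟨i, hi, rfl⟩ := Finset.mem_image.mp hb
    simpa using hle i hi
  have h3 := card_le_of_sum_two_pow_eq (B := (Finset.Icc 1 s).image c ∪ Finset.range (c (s + 1)))
    (J := J.disjSum (Finset.range (s - t))) (a := Sum.elim a fun _ => 0) (by
      rw [Finset.sum_union hdisj, Finset.sum_image hinj, h2, Finset.sum_disjSum]
      rw [Finset.sum_Icc_succ_top (by omega)] at h
      simp only [Sum.elim_inl, Sum.elim_inr, ← h]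
      simp only [pow_zero, Finset.sum_const, Finset.card_range, smul_eq_mul, mul_one]
      omega)
  rw [Finset.card_union_of_disjoint hdisj, Finset.card_image_of_injOn hinj,
    Finset.card_disjSum] at h3
  simp at h3
  omega

end BinaryExpansion

section Regular

variable {k r n : ℕ} {φ : Module.Dual (ZMod 2) (F2Poly k)}

/-- Functionals on `P_k` vanishing on hit polynomials of degree `n` only see monomials with
exactly `r` odd exponents. -/
def IsRegularDegree (k r n : ℕ) : Prop :=
  ∀ φ ∈ hitAnnihilator k n, ∀ J : Finset (Fin k), J.card ≠ r → ∀ y, φ (raise J y) = 0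

lemma apply_raise_SqTotal (hreg : IsRegularDegree k r n) (hφ : φ ∈ hitAnnihilator k n)
    {J : Finset (Fin k)} (hJ : J.card = r) (y : F2Poly k) :
    φ (raise J (SqTotal k y)) = φ (raise J y) := by
  rw [← apply_SqTotal hφ (raise J y), SqTotal_raise, map_sum, Finset.sum_eq_single J]
  · simp [varProd]
  · intro I hI hne
    refine hreg φ hφ I (fun h => hne ?_) _
    exact Finset.eq_of_subset_of_card_le (Finset.mem_powerset.mp hI) (by omega)
  · simp

lemma comp_raise_mem (hreg : IsRegularDegree k r (2 * n + r))
    (hφ : φ ∈ hitAnnihilator k (2 * n + r)) {J : Finset (Fin k)} (hJ : J.card = r) :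
    φ ∘ₗ raise J ∈ hitAnnihilator k n := by
  refine ⟨LinearMap.ext fun y => apply_raise_SqTotal hreg hφ hJ y, fun e he => ?_⟩
  rw [LinearMap.comp_apply, raise_monomial, hφ.2]
  rw [raise_monomial_degree]
  omega

/-- Kameko's isomorphism. -/
noncomputable def kamekoEquiv (hreg : IsRegularDegree r r (2 * n + r)) :
    hitAnnihilator r (2 * n + r) ≃ₗ[ZMod 2] hitAnnihilator r n where
  toFun φ := ⟨φ.1 ∘ₗ raise Finset.univ, comp_raise_mem hreg φ.2 (by simp)⟩
  map_add' _ _ := rfl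
  map_smul' _ _ := rfl
  invFun ψ := ⟨ψ.1 ∘ₗ lower Finset.univ, by
    refine ⟨linearMap_ext_raise fun J => LinearMap.ext fun y => ?_, fun e he => ?_⟩
    · simp only [LinearMap.comp_apply, AlgHom.toLinearMap_apply, SqTotal_raise, map_sum,
        lower_raise]
      by_cases hJ : J = Finset.univ
      · subst hJ
        rw [Finset.sum_eq_single Finset.univ (by simp +contextual) (by simp)]
        simpa [varProd] using apply_SqTotal ψ.2 y
      · rw [Finset.sum_eq_zero, if_neg hJ, map_zero]
        intro I hI
        rw [if_neg, map_zero]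
        rintro rfl
        exact hJ (Finset.univ_subset_iff.mp (Finset.mem_powerset.mp hI))
    · rw [LinearMap.comp_apply, lower_monomial]
      split_ifs with h
      · refine ψ.2.2 _ fun h' => he ?_
        rw [← indicatorExp_oddPart_add e, raise_monomial_degree, h, h', Finset.card_fin]
        omega
      · exact map_zero _⟩
  left_inv φ := by
    refine Subtype.ext (linearMap_ext_raise fun J => LinearMap.ext fun y => ?_)
    simp only [LinearMap.comp_apply, lower_raise]
    split_ifs with h
    · rw [h]
    · rw [map_zero, map_zero, hreg φ.1 φ.2 J]
      exact fun h' => h (Finset.eq_univ_of_card J (by rw [h', Fintype.card_fin]))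
  right_inv ψ := by
    refine Subtype.ext (LinearMap.ext fun y => ?_)
    simp [LinearMap.comp_apply, lower_raise]

end Regular

section Words

variable {r n : ℕ} {φ : Module.Dual (ZMod 2) (F2Poly (r + 1))}

lemma card_compl_singleton (i : Fin (r + 1)) : ({i}ᶜ : Finset (Fin (r + 1))).card = r := by
  simp [Finset.card_compl]

lemma exists_eq_compl_singleton {J : Finset (Fin (r + 1))} (hJ : J.card = r) :
    ∃ i, J = {i}ᶜ := by
  have : Jᶜ.card = 1 := by
    rw [Finset.card_compl, Fintype.card_fin]
    omega
  obtain ⟨i, hi⟩ := Finset.card_eq_one.mp this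
  exact ⟨i, by rw [← hi, compl_compl]⟩

lemma sum_eq_sum_compl_singleton {M : Type*} [AddCommMonoid M] {F : Finset (Fin (r + 1)) → M}
    (hF : ∀ J, J.card ≠ r → F J = 0) : ∑ J, F J = ∑ i, F {i}ᶜ := by
  refine (Finset.sum_of_injOn (s := Finset.univ) (t := Finset.univ)
    (fun i : Fin (r + 1) => ({i}ᶜ : Finset (Fin (r + 1)))) ?_ (by simp [Set.MapsTo]) ?_
    (fun _ _ => rfl)).symm
  · intro i _ j _ h
    simpa using h
  · intro J _ hJ
    refine hF J fun h => hJ ?_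
    obtain ⟨i, rfl⟩ := exists_eq_compl_singleton h
    exact ⟨i, by simp⟩

lemma X_mul_raise_univ (i : Fin (r + 1)) (w : F2Poly (r + 1)) :
    X i * raise Finset.univ w = raise {i}ᶜ (X i * w) := by
  rw [X_mul_raise_of_mem (Finset.mem_univ i), Finset.compl_singleton]

/-- Precomposition with `raise {i}ᶜ`. -/
noncomputable def raiseDual (i : Fin (r + 1)) :
    Module.Dual (ZMod 2) (F2Poly (r + 1)) →ₗ[ZMod 2] Module.Dual (ZMod 2) (F2Poly (r + 1)) :=
  (raise {i}ᶜ).dualMap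

lemma raiseDual_apply (i : Fin (r + 1)) (y : F2Poly (r + 1)) :
    raiseDual i φ y = φ (raise {i}ᶜ y) := rfl

/-- Iterated application of `raiseDual` along a word. -/
noncomputable def raiseDualWord : List (Fin (r + 1)) →
    (Module.Dual (ZMod 2) (F2Poly (r + 1)) →ₗ[ZMod 2] Module.Dual (ZMod 2) (F2Poly (r + 1)))
  | [] => LinearMap.id
  | i :: w => raiseDualWord w ∘ₗ raiseDual i

lemma raiseDualWord_nil : raiseDualWord [] φ = φ := rfl

lemma raiseDualWord_cons (i : Fin (r + 1)) (w : List (Fin (r + 1))) :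
    raiseDualWord (i :: w) φ = raiseDualWord w (raiseDual i φ) := rfl

lemma raiseDualWord_append (w w' : List (Fin (r + 1))) :
    raiseDualWord (w ++ w') φ = raiseDualWord w' (raiseDualWord w φ) := by
  induction w generalizing φ with
  | nil => rfl
  | cons i w ih => rw [List.cons_append, raiseDualWord_cons, ih, raiseDualWord_cons]

lemma raiseDual_mem (hreg : IsRegularDegree (r + 1) r (2 * n + r))
    (hφ : φ ∈ hitAnnihilator (r + 1) (2 * n + r)) (i : Fin (r + 1)) :
    raiseDual i φ ∈ hitAnnihilator (r + 1) n :=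
  comp_raise_mem hreg hφ (card_compl_singleton i)

lemma sum_raiseDual_X_mul (hreg : IsRegularDegree (r + 1) r (2 * n + r))
    (hφ : φ ∈ hitAnnihilator (r + 1) (2 * n + r)) (z : F2Poly (r + 1)) :
    ∑ i, raiseDual i φ (X i * z) = 0 := by
  have key : ∑ i, raiseDual i φ ∘ₗ LinearMap.mulLeft (ZMod 2) (X i) = 0 := by
    refine eq_zero_of_comp_SqTotal (c := 1) (n := n) (fun e he => ?_) fun f => ?_
    · rw [LinearMap.sum_apply]
      refine Finset.sum_eq_zero fun i _ => ?_
      rw [LinearMap.comp_apply, LinearMap.mulLeft_apply, ← monomial_add_single_one]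
      refine (raiseDual_mem hreg hφ i).2 _ ?_
      rwa [map_add, Finsupp.degree_single]
    · have h := apply_SqTotal hφ (raise Finset.univ f)
      rw [hreg φ hφ Finset.univ (by simp), SqTotal_raise, map_sum, Finset.powerset_univ,
        sum_eq_sum_compl_singleton fun J hJ => hreg φ hφ J hJ _] at h
      simpa [raiseDual_apply, varProd, ← Finset.compl_eq_univ_sdiff] using h
  simpa using LinearMap.congr_fun key z

/-- Consecutive degrees `ν 0, …, ν T` in which the maps `raiseDual` are available. -/
structure IsTower (r T : ℕ) (ν : ℕ → ℕ) : Prop where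
  step : ∀ t < T, ν (t + 1) = 2 * ν t + r
  regular : ∀ t < T, IsRegularDegree (r + 1) r (ν (t + 1))

namespace IsTower

variable {T : ℕ} {ν : ℕ → ℕ} {t : ℕ}

lemma raiseDual_mem (hν : IsTower r T ν) (ht : t < T) (hφ : φ ∈ hitAnnihilator (r + 1) (ν (t + 1)))
    (i : Fin (r + 1)) : raiseDual i φ ∈ hitAnnihilator (r + 1) (ν t) := by
  have hreg := hν.regular t ht
  rw [hν.step t ht] at hφ hreg
  exact _root_.raiseDual_mem hreg hφ i

lemma sum_raiseDual_X_mul (hν : IsTower r T ν) (ht : t < T)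
    (hφ : φ ∈ hitAnnihilator (r + 1) (ν (t + 1))) (z : F2Poly (r + 1)) :
    ∑ i, raiseDual i φ (X i * z) = 0 := by
  have hreg := hν.regular t ht
  rw [hν.step t ht] at hφ hreg
  exact _root_.sum_raiseDual_X_mul hreg hφ z

lemma raiseDualWord_mem (hν : IsTower r T ν) (w : List (Fin (r + 1))) (ht : t + w.length ≤ T)
    (hφ : φ ∈ hitAnnihilator (r + 1) (ν (t + w.length))) :
    raiseDualWord w φ ∈ hitAnnihilator (r + 1) (ν t) := by
  induction w generalizing φ with
  | nil => exact hφ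
  | cons i w ih =>
    rw [List.length_cons, ← add_assoc] at ht hφ
    exact ih (by omega) (hν.raiseDual_mem (by omega) hφ i)

lemma raiseDual_eq_of_sum_eq_zero (hν : IsTower r T ν) (ht : t < T)
    {χ : Fin (r + 1) → Module.Dual (ZMod 2) (F2Poly (r + 1))}
    (hχ : ∀ i, χ i ∈ hitAnnihilator (r + 1) (ν (t + 1)))
    (hsum : ∀ z, ∑ i, χ i (X i * z) = 0) {a b : Fin (r + 1)} (hab : a ≠ b) :
    raiseDual b (χ a) = raiseDual a (χ b) := by
  have hcard : ({a, b}ᶜ : Finset (Fin (r + 1))).card + 2 = r + 1 := by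
    have := Finset.card_add_card_compl ({a, b} : Finset (Fin (r + 1)))
    rw [Finset.card_pair hab, Fintype.card_fin] at this
    omega
  refine LinearMap.ext fun w => ?_
  have h := hsum (raise {a, b}ᶜ w)
  rw [Fintype.sum_eq_add a b hab, X_mul_raise_of_notMem (by simp), X_mul_raise_of_notMem (by simp),
    show insert a ({a, b}ᶜ : Finset (Fin (r + 1))) = {b}ᶜ by ext j; simp; grind,
    show insert b ({a, b}ᶜ : Finset (Fin (r + 1))) = {a}ᶜ by ext j; simp; grind] at h
  · exact CharTwo.add_eq_zero.mp h
  · rintro i ⟨hia, hib⟩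
    rw [X_mul_raise_of_mem (by simp [hia, hib]), hν.regular t ht _ (hχ i)]
    have := Finset.card_erase_le (s := ({a, b}ᶜ : Finset (Fin (r + 1)))) (a := i)
    omega

lemma raiseDual_comm (hν : IsTower r T ν) (ht : t + 1 < T)
    (hφ : φ ∈ hitAnnihilator (r + 1) (ν (t + 2))) (a b : Fin (r + 1)) :
    raiseDual a (raiseDual b φ) = raiseDual b (raiseDual a φ) := by
  by_cases hab : a = b
  · rw [hab]
  · exact hν.raiseDual_eq_of_sum_eq_zero (χ := fun i => raiseDual i φ) (by omega)
      (hν.raiseDual_mem ht hφ) (hν.sum_raiseDual_X_mul ht hφ) (Ne.symm hab)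

lemma sum_raiseDualWord_replicate_X_mul (hν : IsTower r T ν) (s : ℕ) (ht : t + s < T)
    (hφ : φ ∈ hitAnnihilator (r + 1) (ν (t + s + 1))) (z : F2Poly (r + 1)) :
    ∑ i, raiseDualWord (List.replicate (s + 1) i) φ (X i * z) = 0 := by
  induction s generalizing t z with
  | zero => exact hν.sum_raiseDual_X_mul ht hφ z
  | succ s ih =>
    have := ih (t := t + 1) (by omega) (by rwa [add_right_comm t 1 s]) (raise Finset.univ z)
    simp only [X_mul_raise_univ] at this
    simp only [List.replicate_succ' (n := s + 1), raiseDualWord_append]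
    exact this

lemma raiseDual_sq_comm (hν : IsTower r T ν) (ht : t + 2 < T)
    (hφ : φ ∈ hitAnnihilator (r + 1) (ν (t + 3))) {a b : Fin (r + 1)} (hab : a ≠ b) :
    raiseDualWord [a, a, b] φ = raiseDualWord [b, b, a] φ := by
  have hmem : ∀ i, raiseDualWord [i, i] φ ∈ hitAnnihilator (r + 1) (ν (t + 1)) := fun i =>
    hν.raiseDualWord_mem [i, i] (t := t + 1) ht hφ
  have hsum : ∀ z, ∑ i, raiseDualWord [i, i] φ (X i * z) = 0 :=
    hν.sum_raiseDualWord_replicate_X_mul 1 (t := t + 1) ht hφ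
  simpa only [raiseDualWord_cons, raiseDualWord_nil] using
    hν.raiseDual_eq_of_sum_eq_zero (by omega) hmem hsum hab

lemma raiseDualWord_perm (hν : IsTower r T ν) {w w' : List (Fin (r + 1))} (h : w.Perm w')
    (ht : w.length ≤ T) (hφ : φ ∈ hitAnnihilator (r + 1) (ν w.length)) :
    raiseDualWord w φ = raiseDualWord w' φ := by
  induction h generalizing φ with
  | nil => rfl
  | cons i h ih =>
    exact ih (by rw [List.length_cons] at ht; omega) (hν.raiseDual_mem ht hφ i)
  | swap i j w =>
    simp only [raiseDualWord_cons]
    rw [hν.raiseDual_comm ht hφ]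
  | trans h h' ih ih' => rw [ih ht hφ, ih' (h.length_eq ▸ ht) (h.length_eq ▸ hφ)]

lemma exists_raiseDualWord_cons_eq (hν : IsTower r T ν) {a : Fin (r + 1)} {u : List (Fin (r + 1))}
    (ht : u.length < T) (hφ : φ ∈ hitAnnihilator (r + 1) (ν (u.length + 1))) (ha : a ∉ u)
    (hu : u.toFinset.card < u.length) :
    ∃ u' : List (Fin (r + 1)), u'.length = u.length ∧ u'.toFinset = insert a u.toFinset ∧
      raiseDualWord (a :: u) φ = raiseDualWord (a :: u') φ := by
  have hdup : ¬ u.Nodup := fun h => hu.ne (List.toFinset_card_of_nodup h)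
  obtain ⟨b, hb⟩ := List.exists_duplicate_iff_not_nodup.mpr hdup
  obtain ⟨v, hv⟩ := (List.duplicate_iff_sublist.mp hb).exists_perm_append
  have hlen := hv.length_eq
  have hset := List.toFinset_eq_of_perm _ _ hv
  simp only [List.cons_append, List.nil_append, List.length_cons] at hv hlen
  have hab : b ≠ a := fun h => ha (h ▸ hb.mem)
  refine ⟨a :: b :: v, by simp [hlen], by rw [hset]; simp, ?_⟩
  have hperm : (a :: u).Perm ([b, b, a] ++ v) :=
    (hv.cons a).trans (List.perm_append_comm (l₁ := [a]) (l₂ := [b, b]) |>.append_right v)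
  rw [hν.raiseDualWord_perm hperm ht hφ, raiseDualWord_append,
    hν.raiseDual_sq_comm (t := v.length) (by omega) (by rwa [hlen] at hφ) hab]
  rfl

lemma raiseDualWord_eq_of_toFinset_eq (hν : IsTower r T ν) {w w' : List (Fin (r + 1))}
    (hlen : w.length = w'.length) (hset : w.toFinset = w'.toFinset)
    (ht : w.length ≤ T) (hφ : φ ∈ hitAnnihilator (r + 1) (ν w.length)) :
    raiseDualWord w φ = raiseDualWord w' φ := by
  induction h : w.length generalizing w w' φ with
  | zero =>
    rw [h] at hlen
    rw [List.length_eq_zero_iff.mp h, List.length_eq_zero_iff.mp hlen.symm]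
  | succ s ih =>
    obtain ⟨a, u, rfl⟩ := List.exists_cons_of_length_eq_add_one h
    have ha : a ∈ w' := by
      rw [← List.mem_toFinset, ← hset]
      simp
    obtain ⟨u', hu'⟩ : ∃ u', w'.Perm (a :: u') := ⟨_, List.perm_cons_erase ha⟩
    have hlen' := hu'.length_eq
    rw [hν.raiseDualWord_perm hu' (hlen ▸ ht) (hlen ▸ hφ)]
    rw [List.toFinset_eq_of_perm _ _ hu', List.toFinset_cons, List.toFinset_cons] at hset
    simp only [List.length_cons] at h hlen hlen' ht hφ
    have hmem := fun i => hν.raiseDual_mem ht hφ i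
    by_cases hau : a ∈ u <;> by_cases hau' : a ∈ u'
    · rw [Finset.insert_eq_of_mem (by simpa), Finset.insert_eq_of_mem (by simpa)] at hset
      rw [raiseDualWord_cons, raiseDualWord_cons]
      exact ih (by omega) hset (by omega) (hmem a) (by omega)
    · have hlt : u'.toFinset.card < u'.length := by
        have h1 := congrArg Finset.card hset
        rw [Finset.insert_eq_of_mem (by simpa), Finset.card_insert_of_notMem (by simpa)] at h1
        have h2 := u.toFinset_card_le
        omega
      obtain ⟨v, hv1, hv2, hv3⟩ := hν.exists_raiseDualWord_cons_eq (by omega)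
        (by rwa [show u'.length = u.length by omega]) hau' hlt
      rw [hv3]
      rw [Finset.insert_eq_of_mem (by simpa), ← hv2] at hset
      rw [raiseDualWord_cons, raiseDualWord_cons]
      exact ih (by omega) hset (by omega) (hmem a) (by omega)
    · have hlt : u.toFinset.card < u.length := by
        have h1 := congrArg Finset.card hset
        rw [Finset.insert_eq_of_mem (a := a) (s := u'.toFinset) (by simpa),
          Finset.card_insert_of_notMem (by simpa)] at h1
        have h2 := u'.toFinset_card_le
        omega
      obtain ⟨v, hv1, hv2, hv3⟩ := hν.exists_raiseDualWord_cons_eq (by omega) hφ hau hlt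
      rw [hv3]
      rw [Finset.insert_eq_of_mem (a := a) (s := u'.toFinset) (by simpa), ← hv2] at hset
      rw [raiseDualWord_cons, raiseDualWord_cons]
      refine ih (w := v) (by omega) hset (by omega) ?_ (by omega)
      rw [hv1]
      exact hmem a
    · rw [raiseDualWord_cons, raiseDualWord_cons]
      refine ih (by omega) ?_ (by omega) (hmem a) (by omega)
      rw [← Finset.erase_insert (a := a) (s := u.toFinset) (by simpa), hset,
        Finset.erase_insert (by simpa)]

lemma eq_zero_of_raiseDualWord (hν : IsTower r T ν) (ht : t ≤ T)
    (hφ : φ ∈ hitAnnihilator (r + 1) (ν t))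
    (h : ∀ w : List (Fin (r + 1)), w.length = t → raiseDualWord w φ = 0) : φ = 0 := by
  induction t generalizing φ with
  | zero => exact h [] rfl
  | succ t ih =>
    refine linearMap_ext_raise fun J => LinearMap.ext fun y => ?_
    by_cases hJ : J.card = r
    · obtain ⟨i, rfl⟩ := exists_eq_compl_singleton hJ
      have := ih (by omega) (hν.raiseDual_mem ht hφ i) fun w hw => h (i :: w) (by simp [hw])
      exact LinearMap.congr_fun this y
    · exact hν.regular t ht φ hφ J hJ y

end IsTower

end Words

section Moebius

variable {α M : Type*} [Fintype α] [DecidableEq α] [AddCommGroup M] [Module (ZMod 2) M]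

lemma card_filter_subset_subset {S N : Finset α} (h : S ⊆ N) :
    (Finset.univ.filter fun L => S ⊆ L ∧ L ⊆ N).card = 2 ^ (N.card - S.card) := by
  rw [← Finset.card_Icc_finset h]
  congr 1
  ext L
  simp

lemma two_pow_nsmul_eq_zero {s : ℕ} (hs : s ≠ 0) (x : M) : 2 ^ s • x = 0 := by
  obtain ⟨t, rfl⟩ := Nat.exists_eq_succ_of_ne_zero hs
  have h2 : (2 : ℕ) • x = 0 := by
    rw [← Nat.cast_smul_eq_nsmul (ZMod 2), show ((2 : ℕ) : ZMod 2) = 0 from rfl, zero_smul]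
  rw [pow_succ, mul_smul, h2, smul_zero]

/-- Möbius inversion modulo two over supersets. -/
lemma sum_superset_sum_superset (f : Finset α → M) (S : Finset α) :
    ∑ L with S ⊆ L, ∑ N with L ⊆ N, f N = f S := by
  have h1 : ∑ L with S ⊆ L, ∑ N with L ⊆ N, f N =
      ∑ N, ∑ L with S ⊆ L ∧ L ⊆ N, f N :=
    Finset.sum_comm' (by simp)
  rw [h1, Finset.sum_eq_single S]
  · simp [Finset.sum_const, card_filter_subset_subset]
  · intro N _ hN
    rw [Finset.sum_const]
    by_cases h : S ⊆ N
    · rw [card_filter_subset_subset h, two_pow_nsmul_eq_zero]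
      have := Finset.card_lt_card (Finset.ssubset_iff_subset_ne.mpr ⟨h, hN.symm⟩)
      omega
    · rw [Finset.card_eq_zero.mpr, zero_smul]
      ext L
      simpa using fun h1 h2 => h (h1.trans h2)
  · simp

end Moebius

section LinearForms

variable {k n : ℕ}

/-- The sum of the variables indexed by `L`. -/
noncomputable def linForm (L : Finset (Fin k)) : F2Poly k := ∑ j ∈ L, X j

/-- The functionals in `hitAnnihilator k n` which vanish on the multiples of `linForm L`. -/
noncomputable def linFormAnnihilator (L : Finset (Fin k)) (n : ℕ) :
    Submodule (ZMod 2) (Module.Dual (ZMod 2) (F2Poly k)) :=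
  hitAnnihilator k n ⊓ (LinearMap.range (LinearMap.mulLeft (ZMod 2) (linForm L))).dualAnnihilator

lemma mem_linFormAnnihilator {L : Finset (Fin k)} {ψ : Module.Dual (ZMod 2) (F2Poly k)} :
    ψ ∈ linFormAnnihilator L n ↔ ψ ∈ hitAnnihilator k n ∧ ∀ f, ψ (linForm L * f) = 0 := by
  simp [linFormAnnihilator, Submodule.mem_dualAnnihilator]

lemma eq_zero_of_forall_X_mul {ψ : Module.Dual (ZMod 2) (F2Poly k)} (hψ : ψ ∈ hitAnnihilator k n)
    (hn : n ≠ 0) (h : ∀ j f, ψ (X j * f) = 0) : ψ = 0 := by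
  refine linearMap_ext_monomial fun e => ?_
  rw [LinearMap.zero_apply]
  by_cases he : e = 0
  · exact hψ.2 e (by simpa [he] using hn.symm)
  · obtain ⟨e', j, rfl⟩ := exists_eq_add_single he
    rw [monomial_add_single_one, h]

/-- Functionals `l j` with `l i (x_j f) = l j (x_i f)` extend to one functional `θ` with
`θ (x_j f) = l j f`. -/
lemma exists_apply_X_mul_eq (l : Fin k → Module.Dual (ZMod 2) (F2Poly k))
    (hl : ∀ i j f, l i (X j * f) = l j (X i * f)) :
    ∃ θ : Module.Dual (ZMod 2) (F2Poly k), θ 1 = 0 ∧ ∀ j f, θ (X j * f) = l j f := by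
  classical
  let θ : Module.Dual (ZMod 2) (F2Poly k) :=
    (basisMonomials (Fin k) (ZMod 2)).constr (ZMod 2) fun e =>
      if h : e = 0 then 0 else
        l (exists_eq_add_single h).choose_spec.choose
          (monomial (exists_eq_add_single h).choose 1)
  have hθ : ∀ e, θ (monomial e 1) = if h : e = 0 then 0 else
      l (exists_eq_add_single h).choose_spec.choose
        (monomial (exists_eq_add_single h).choose 1) := fun e => by
    have := (basisMonomials (Fin k) (ZMod 2)).constr_basis (ZMod 2) (fun e =>
      if h : e = 0 then (0 : ZMod 2) else
        l (exists_eq_add_single h).choose_spec.choose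
          (monomial (exists_eq_add_single h).choose 1)) e
    rwa [coe_basisMonomials] at this
  refine ⟨θ, by rw [show (1 : F2Poly k) = monomial 0 1 from rfl, hθ, dif_pos rfl], fun j f => ?_⟩
  have : θ ∘ₗ LinearMap.mulLeft (ZMod 2) (X j) = l j := by
    refine linearMap_ext_monomial fun e => ?_
    rw [LinearMap.comp_apply, LinearMap.mulLeft_apply, ← monomial_add_single_one, hθ]
    have hne : e + Finsupp.single j 1 ≠ 0 := fun h => by
      simpa using DFunLike.congr_fun h j
    rw [dif_neg hne]
    have hspec := (exists_eq_add_single hne).choose_spec.choose_spec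
    generalize (exists_eq_add_single hne).choose_spec.choose = i at hspec ⊢
    generalize (exists_eq_add_single hne).choose = e' at hspec ⊢
    by_cases hij : i = j
    · subst hij
      rw [add_right_cancel hspec]
    · have hle : Finsupp.single i 1 ≤ e := by
        rw [Finsupp.single_le_iff]
        have := DFunLike.congr_fun hspec i
        simp [Ne.symm hij] at this
        omega
      obtain ⟨u, rfl⟩ := exists_add_of_le hle
      have he' : e' = u + Finsupp.single j 1 := by
        refine add_right_cancel (b := Finsupp.single i 1) ?_
        rw [← hspec]
        abel
      rw [he', add_comm _ u, monomial_add_single_one, monomial_add_single_one, hl]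
  exact LinearMap.congr_fun this f

/-- Functionals `Φ S` killed in suitable linear combinations by the variables arise by summation
over supersets from functionals which vanish on multiples of linear forms. -/
lemma exists_linFormAnnihilator_sum_eq {r : ℕ}
    {Φ : Finset (Fin (r + 1)) → Module.Dual (ZMod 2) (F2Poly (r + 1))}
    (hΦ : ∀ S, Φ S ∈ hitAnnihilator (r + 1) n) (huniv : Φ Finset.univ = 0)
    (hsum : ∀ S, S.card < r → ∀ z, ∑ j, Φ (insert j S) (X j * z) = 0) :
    ∃ ψ : Finset (Fin (r + 1)) → Module.Dual (ZMod 2) (F2Poly (r + 1)),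
      (∀ L, ψ L ∈ linFormAnnihilator L n) ∧
      ∀ S, S.card ≤ r → ∑ L with S ⊆ L, ψ L = Φ S := by
  set θ : Finset (Fin (r + 1)) → Module.Dual (ZMod 2) (F2Poly (r + 1)) :=
    fun L => ∑ S with L ⊆ S, Φ S with hθdef
  have hθ : ∀ L, θ L ∈ hitAnnihilator (r + 1) n := fun L =>
    Submodule.sum_mem _ fun S _ => hΦ S
  have hθsum : ∀ S, ∑ L with S ⊆ L, θ L = Φ S := sum_superset_sum_superset Φ
  -- sums over supersets of the values at multiples of linear forms
  have hC : ∀ S z, ∑ L with S ⊆ L, θ L (linForm L * z) = ∑ j, Φ (insert j S) (X j * z) := by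
    intro S z
    have h1 : ∀ L, θ L (linForm L * z) = ∑ j ∈ L, θ L (X j * z) := fun L => by
      rw [linForm, Finset.sum_mul, map_sum]
    simp only [h1]
    rw [Finset.sum_comm' (t' := Finset.univ)
      (s' := fun j => Finset.univ.filter fun L => insert j S ⊆ L)
      (by simp [Finset.insert_subset_iff, and_comm])]
    refine Finset.sum_congr rfl fun j _ => ?_
    rw [← hθsum (insert j S), LinearMap.sum_apply]
  have hC0 : ∀ S z, S.card ≠ r → ∑ L with S ⊆ L, θ L (linForm L * z) = 0 := by
    intro S z hS
    rw [hC]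
    rcases hS.lt_or_gt with h | h
    · exact hsum S h z
    · have : S = Finset.univ := Finset.eq_univ_of_card _ (by
        have := S.card_le_univ
        rw [Fintype.card_fin] at this ⊢
        omega)
      simp [this, huniv]
  have hCi : ∀ L z, θ L (linForm L * z) = ∑ i, if i ∈ L then 0 else
      ∑ L' with {i}ᶜ ⊆ L', θ L' (linForm L' * z) := by
    intro L z
    rw [← sum_superset_sum_superset (fun L => θ L (linForm L * z)) L, Finset.sum_filter,
      sum_eq_sum_compl_singleton]
    · refine Finset.sum_congr rfl fun i _ => ?_
      by_cases hi : i ∈ L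
      · rw [if_pos hi, if_neg]
        exact fun h => by simpa using h hi
      · rw [if_neg hi, if_pos]
        exact fun j hj => by
          rw [Finset.mem_compl, Finset.mem_singleton]
          rintro rfl
          exact hi hj
    · intro J hJ
      rw [hC0 J z hJ, ite_self]
  set l : Fin (r + 1) → Module.Dual (ZMod 2) (F2Poly (r + 1)) :=
    fun i => θ {i} ∘ₗ LinearMap.mulLeft (ZMod 2) (X i) with hl
  have hlapp : ∀ i z, l i z = θ {i} (X i * z) := fun i z => rfl
  have hLl : ∀ L z, θ L (linForm L * z) = ∑ i ∈ L, l i z := by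
    intro L z
    set D : Fin (r + 1) → ZMod 2 := fun i => ∑ L' with {i}ᶜ ⊆ L', θ L' (linForm L' * z)
    have hD : ∑ i, D i = 0 := by
      have := hCi ∅ z
      rw [linForm, Finset.sum_empty, zero_mul, map_zero] at this
      simpa using this.symm
    have hL : ∀ L, θ L (linForm L * z) = ∑ i ∈ L, D i := by
      intro L
      have h1 : θ L (linForm L * z) = ∑ i, if i ∈ L then 0 else D i := hCi L z
      have h2 : ∑ i, (if i ∈ L then 0 else D i) + ∑ i ∈ L, D i = 0 := by
        refine Eq.trans ?_ hD
        rw [← Finset.sum_filter_add_sum_filter_not Finset.univ (· ∈ L) D, add_comm,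
          Finset.sum_ite, Finset.sum_const_zero, zero_add, Finset.filter_univ_mem]
      rw [h1]
      exact CharTwo.add_eq_zero.mp h2
    rw [hL]
    refine Finset.sum_congr rfl fun i _ => ?_
    have := hL {i}
    rw [Finset.sum_singleton, linForm, Finset.sum_singleton] at this
    exact this.symm
  -- invariance under the total square
  have hSq : ∀ L z, ∑ i ∈ L, l i (SqTotal _ z) + ∑ i ∈ L, l i (linForm L * SqTotal _ z) =
      ∑ i ∈ L, l i z := by
    intro L z
    have hlin : SqTotal (r + 1) (linForm L) = linForm L + linForm L ^ 2 := by
      simp only [linForm, map_sum, SqTotal_X, Finset.sum_add_distrib, CharTwo.sum_sq]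
    rw [← hLl, ← hLl, ← hLl, ← apply_SqTotal (hθ L) (linForm L * z), ← (θ L).map_add,
      _root_.map_mul (SqTotal _), hlin]
    congr 1
    ring
  have hsymm : ∀ i j f, l i (X j * f) = l j (X i * f) := by
    intro i j f
    by_cases hij : i = j
    · rw [hij]
    have key : l i ∘ₗ LinearMap.mulLeft (ZMod 2) (X j) +
        l j ∘ₗ LinearMap.mulLeft (ZMod 2) (X i) = 0 := by
      refine eq_zero_of_comp_SqTotal (c := 2) (n := n) (fun e he => ?_) fun z => ?_
      · have h0 : ∀ a b : Fin (r + 1), l a (X b * monomial e 1) = 0 := fun a b => by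
          rw [hlapp, ← monomial_add_single_one, ← monomial_add_single_one]
          refine (hθ _).2 _ ?_
          simp only [map_add, Finsupp.degree_single]
          omega
        simp [h0]
      · have h1 := hSq {i} z
        have h2 := hSq {j} z
        have h3 := hSq {i, j} z
        simp only [linForm, Finset.sum_singleton, Finset.sum_pair hij, add_mul, map_add]
          at h1 h2 h3
        simp only [LinearMap.add_apply, LinearMap.comp_apply, LinearMap.mulLeft_apply]
        linear_combination h3 - h1 - h2
    have := LinearMap.congr_fun key f
    exact CharTwo.add_eq_zero.mp this
  obtain ⟨θ₀, hθ₀1, hθ₀X⟩ := exists_apply_X_mul_eq l hsymm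
  have hθ₀ : θ₀ ∈ hitAnnihilator (r + 1) n := by
    refine ⟨linearMap_ext_monomial fun e => ?_, fun e he => ?_⟩
    · rw [LinearMap.comp_apply, AlgHom.toLinearMap_apply]
      by_cases he : e = 0
      · rw [he, show (monomial 0 1 : F2Poly (r + 1)) = 1 from rfl, map_one]
      · obtain ⟨e', j, rfl⟩ := exists_eq_add_single he
        have h1 := hSq {j} (monomial e' 1)
        simp only [linForm, Finset.sum_singleton] at h1
        rw [monomial_add_single_one, map_mul, SqTotal_X, hθ₀X, ← h1, ← map_add, ← hθ₀X]
        congr 1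
        ring
    · by_cases h0 : e = 0
      · rw [h0]
        exact hθ₀1
      · obtain ⟨e', j, rfl⟩ := exists_eq_add_single h0
        rw [monomial_add_single_one, hθ₀X, hlapp, ← monomial_add_single_one]
        exact (hθ _).2 _ he
  refine ⟨fun L => θ L + θ₀, fun L => ?_, fun S hS => ?_⟩
  · refine mem_linFormAnnihilator.mpr ⟨add_mem (hθ L) hθ₀, fun f => ?_⟩
    rw [LinearMap.add_apply, hLl, linForm, Finset.sum_mul, map_sum, ← Finset.sum_add_distrib]
    refine Finset.sum_eq_zero fun i _ => ?_
    rw [hθ₀X, CharTwo.add_self_eq_zero]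
  · rw [Finset.sum_add_distrib, hθsum, Finset.sum_const]
    have := card_filter_subset_subset (Finset.subset_univ S)
    simp only [Finset.subset_univ, and_true, Finset.card_fin] at this
    rw [this, two_pow_nsmul_eq_zero (by omega), add_zero]

end LinearForms

section LowerSum

variable {r n : ℕ} {L : Finset (Fin (r + 1))} {ψ : Module.Dual (ZMod 2) (F2Poly (r + 1))}

/-- The sum of the left inverses of `raise {j}ᶜ` over `j ∈ L`. -/
noncomputable def lowerSum (L : Finset (Fin (r + 1))) :
    F2Poly (r + 1) →ₗ[ZMod 2] F2Poly (r + 1) := ∑ j ∈ L, lower {j}ᶜ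

lemma lowerSum_raise_compl_singleton (i : Fin (r + 1)) (y : F2Poly (r + 1)) :
    lowerSum L (raise {i}ᶜ y) = if i ∈ L then y else 0 := by
  simp [lowerSum, lower_raise]

lemma lowerSum_raise_of_card_ne {J : Finset (Fin (r + 1))} (hJ : J.card ≠ r)
    (y : F2Poly (r + 1)) : lowerSum L (raise J y) = 0 := by
  rw [lowerSum, LinearMap.sum_apply]
  refine Finset.sum_eq_zero fun j _ => ?_
  rw [lower_raise, if_neg]
  rintro rfl
  exact hJ (card_compl_singleton j)

lemma apply_lowerSum_SqTotal_raise (hψ : ψ ∈ linFormAnnihilator L n)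
    (J : Finset (Fin (r + 1))) (y : F2Poly (r + 1)) :
    ψ (lowerSum L (SqTotal _ (raise J y))) = ψ (lowerSum L (raise J y)) := by
  rw [mem_linFormAnnihilator] at hψ
  rw [SqTotal_raise, map_sum, map_sum]
  by_cases hJ : J = Finset.univ
  · subst hJ
    rw [Finset.powerset_univ, lowerSum_raise_of_card_ne (by simp), map_zero,
      sum_eq_sum_compl_singleton fun I hI => by rw [lowerSum_raise_of_card_ne hI, map_zero],
      ← hψ.2 (SqTotal _ y), linForm, Finset.sum_mul, map_sum]
    simp [lowerSum_raise_compl_singleton, varProd, apply_ite ψ]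
  · have hcard : J.card < r + 1 := by
      simpa using (Finset.card_lt_iff_ne_univ J).mpr hJ
    rw [Finset.sum_eq_single J]
    · by_cases hr : J.card = r
      · obtain ⟨i, rfl⟩ := exists_eq_compl_singleton hr
        simp [lowerSum_raise_compl_singleton, varProd, apply_ite ψ, apply_SqTotal hψ.1]
      · rw [lowerSum_raise_of_card_ne hr, lowerSum_raise_of_card_ne hr]
    · intro I hI hne
      have := Finset.card_lt_card ((Finset.mem_powerset.mp hI).ssubset_of_ne hne)
      rw [lowerSum_raise_of_card_ne (by omega), map_zero]
    · simp

lemma apply_lowerSum_linForm_mul_raise (hψ : ψ ∈ linFormAnnihilator L n)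
    (J : Finset (Fin (r + 1))) (y : F2Poly (r + 1)) :
    ψ (lowerSum L (linForm L * raise J y)) = 0 := by
  rw [mem_linFormAnnihilator] at hψ
  rw [linForm, Finset.sum_mul, map_sum, map_sum]
  by_cases hJ : J = Finset.univ
  · subst hJ
    rw [← hψ.2 y, linForm, Finset.sum_mul, map_sum]
    refine Finset.sum_congr rfl fun j hj => ?_
    rw [X_mul_raise_univ, lowerSum_raise_compl_singleton, if_pos hj]
  have hcard : J.card < r + 1 := by
    simpa using (Finset.card_lt_iff_ne_univ J).mpr hJ
  have hzero : ∀ j, (j ∈ J ∨ J.card + 1 ≠ r) → lowerSum L (X j * raise J y) = 0 := by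
    intro j hj
    by_cases hjJ : j ∈ J
    · have := Finset.card_erase_of_mem hjJ
      have := Finset.card_pos.mpr ⟨j, hjJ⟩
      rw [X_mul_raise_of_mem hjJ, lowerSum_raise_of_card_ne (by omega)]
    · have := Finset.card_insert_of_notMem hjJ
      rw [X_mul_raise_of_notMem hjJ, lowerSum_raise_of_card_ne (by simp_all)]
  by_cases hr : J.card + 1 = r
  swap
  · exact Finset.sum_eq_zero fun j _ => by rw [hzero j (Or.inr hr), map_zero]
  have hJc : Jᶜ.card = 2 := by
    rw [Finset.card_compl, Fintype.card_fin]
    omega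
  obtain ⟨a, b, hab, hJab⟩ := Finset.card_eq_two.mp hJc
  have hJ' : J = {a, b}ᶜ := by rw [← hJab, compl_compl]
  subst hJ'
  rw [← Finset.sum_subset (Finset.inter_subset_left (s₁ := L) (s₂ := {a, b}))]
  · have ha : lowerSum L (X a * raise {a, b}ᶜ y) = if b ∈ L then y else 0 := by
      rw [X_mul_raise_of_notMem (by simp),
        show insert a ({a, b}ᶜ : Finset (Fin (r + 1))) = {b}ᶜ by ext j; simp; grind,
        lowerSum_raise_compl_singleton]
    have hb : lowerSum L (X b * raise {a, b}ᶜ y) = if a ∈ L then y else 0 := by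
      rw [X_mul_raise_of_notMem (by simp),
        show insert b ({a, b}ᶜ : Finset (Fin (r + 1))) = {a}ᶜ by ext j; simp; grind,
        lowerSum_raise_compl_singleton]
    by_cases haL : a ∈ L <;> by_cases hbL : b ∈ L
    · rw [Finset.inter_eq_right.mpr (by simp [Finset.insert_subset_iff, haL, hbL]),
        Finset.sum_pair hab, ha, hb, if_pos hbL, if_pos haL, CharTwo.add_self_eq_zero]
    all_goals
      refine Finset.sum_eq_zero fun j hj => ?_
      simp only [Finset.mem_inter, Finset.mem_insert, Finset.mem_singleton] at hj
      rcases hj with ⟨hj, rfl | rfl⟩ <;> simp_all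
  · intro j hj hj'
    rw [hzero j (Or.inl (by simpa [hj] using hj')), map_zero]

lemma comp_lowerSum_mem (hψ : ψ ∈ linFormAnnihilator L n) :
    (lowerSum L).dualMap ψ ∈ linFormAnnihilator L (2 * n + r) := by
  refine mem_linFormAnnihilator.mpr ⟨⟨linearMap_ext_raise fun J => LinearMap.ext fun y =>
    apply_lowerSum_SqTotal_raise hψ J y, fun e he => ?_⟩, fun f => ?_⟩
  · rw [LinearMap.dualMap_apply, lowerSum, LinearMap.sum_apply, map_sum]
    refine Finset.sum_eq_zero fun j _ => ?_
    rw [lower_monomial]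
    split_ifs with h
    · refine (mem_linFormAnnihilator.mp hψ).1.2 _ fun h' => he ?_
      rw [← indicatorExp_oddPart_add e, raise_monomial_degree, h, h', card_compl_singleton]
      omega
    · exact map_zero _
  · have : ψ ∘ₗ lowerSum L ∘ₗ LinearMap.mulLeft (ZMod 2) (linForm L) = 0 :=
      linearMap_ext_raise fun J => LinearMap.ext fun y => apply_lowerSum_linForm_mul_raise hψ J y
    exact LinearMap.congr_fun this f

lemma raiseDual_comp_lowerSum (i : Fin (r + 1)) :
    raiseDual i ((lowerSum L).dualMap ψ) = if i ∈ L then ψ else 0 := by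
  refine LinearMap.ext fun y => ?_
  rw [raiseDual_apply, LinearMap.dualMap_apply, lowerSum_raise_compl_singleton]
  split_ifs <;> simp

lemma raiseDualWord_comp_lowerSum_pow (w : List (Fin (r + 1))) :
    raiseDualWord w (((lowerSum L).dualMap ^ w.length) ψ) =
      if w.toFinset ⊆ L then ψ else 0 := by
  induction w with
  | nil => simp [raiseDualWord_nil]
  | cons i w ih =>
    rw [List.length_cons, pow_succ', Module.End.mul_apply, raiseDualWord_cons,
      raiseDual_comp_lowerSum]
    by_cases hi : i ∈ L <;> simp [hi, ih, Finset.insert_subset_iff]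

lemma IsTower.comp_lowerSum_pow_mem {T : ℕ} {ν : ℕ → ℕ} (hν : IsTower r T ν) {t : ℕ} (ht : t ≤ T)
    (hψ : ψ ∈ linFormAnnihilator L (ν 0)) :
    ((lowerSum L).dualMap ^ t) ψ ∈ linFormAnnihilator L (ν t) := by
  induction t with
  | zero => exact hψ
  | succ t ih =>
    rw [pow_succ', Module.End.mul_apply, hν.step t ht]
    exact comp_lowerSum_mem (ih (by omega))

end LowerSum

section Decomposition

variable {r : ℕ} {ν : ℕ → ℕ}

lemma exists_word {S : Finset (Fin (r + 1))} (hS : S.Nonempty) {s : ℕ} (hs : S.card ≤ s) :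
    ∃ w : List (Fin (r + 1)), w.length = s ∧ w.toFinset = S := by
  obtain ⟨a, ha⟩ := hS
  refine ⟨S.toList ++ List.replicate (s - S.card) a, by simp [hs], ?_⟩
  ext j
  simp only [List.mem_toFinset, List.mem_append, Finset.mem_toList, List.mem_replicate]
  exact ⟨fun h => h.elim id fun h => h.2 ▸ ha, Or.inl⟩

/-- The sum of the maps `ψ ↦ ψ ∘ lowerSum L ^ r` over all nonempty `L`. -/
noncomputable def sumLowerSumPow (hν : IsTower r r ν) :
    (∀ L : {L : Finset (Fin (r + 1)) // L.Nonempty}, linFormAnnihilator L.1 (ν 0)) →ₗ[ZMod 2]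
      hitAnnihilator (r + 1) (ν r) where
  toFun ψ := ⟨∑ L, ((lowerSum L.1).dualMap ^ r) (ψ L).1, by
    refine Submodule.sum_mem _ fun L _ => ?_
    have h := hν.comp_lowerSum_pow_mem (le_refl r) (ψ L).2
    exact (mem_linFormAnnihilator.mp h).1⟩
  map_add' ψ χ := Subtype.ext <| by
    simp only [Pi.add_apply, Submodule.coe_add, map_add, Finset.sum_add_distrib]
  map_smul' c ψ := Subtype.ext <| by
    simp only [Pi.smul_apply, Submodule.coe_smul, map_smul, Finset.smul_sum, RingHom.id_apply]

lemma raiseDualWord_sumLowerSumPow (hν : IsTower r r ν) {w : List (Fin (r + 1))}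
    (hw : w.length = r) (hne : w.toFinset.Nonempty)
    (ψ : ∀ L : {L : Finset (Fin (r + 1)) // L.Nonempty}, linFormAnnihilator L.1 (ν 0))
    {ψ' : Finset (Fin (r + 1)) → Module.Dual (ZMod 2) (F2Poly (r + 1))}
    (hψ' : ∀ L, ψ' L.1 = ψ L) :
    raiseDualWord w (sumLowerSumPow hν ψ).1 = ∑ L with w.toFinset ⊆ L, ψ' L := by
  have h1 : (sumLowerSumPow hν ψ).1 =
      ∑ L : {L : Finset (Fin (r + 1)) // L.Nonempty}, ((lowerSum L.1).dualMap ^ r) (ψ' L.1) := by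
    simp [sumLowerSumPow, hψ']
  rw [h1, map_sum, ← Finset.sum_subtype (Finset.univ.filter Finset.Nonempty) (by simp)
    fun L => raiseDualWord w (((lowerSum L).dualMap ^ r) (ψ' L)), Finset.sum_filter,
    Finset.sum_filter]
  refine Finset.sum_congr rfl fun L _ => ?_
  have h2 := raiseDualWord_comp_lowerSum_pow (L := L) (ψ := ψ' L) w
  rw [hw] at h2
  rw [h2]
  by_cases hL : w.toFinset ⊆ L
  · rw [if_pos (hne.mono hL)]
  · rw [if_neg hL, ite_self]

lemma sumLowerSumPow_injective (hν : IsTower r r ν) (h0 : ν 0 ≠ 0) :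
    Function.Injective (sumLowerSumPow hν) := by
  refine (injective_iff_map_eq_zero _).mpr fun ψ hψ => ?_
  set ψ' : Finset (Fin (r + 1)) → Module.Dual (ZMod 2) (F2Poly (r + 1)) :=
    fun L => if h : L.Nonempty then ψ ⟨L, h⟩ else 0
  have hψ' : ∀ L : {L : Finset (Fin (r + 1)) // L.Nonempty}, ψ' L.1 = ψ L := fun L => dif_pos L.2
  have hzero : ∀ S : Finset (Fin (r + 1)), S.Nonempty → S ≠ Finset.univ →
      ∑ L with S ⊆ L, ψ' L = 0 := by
    intro S hS hne
    have hcard : S.card ≤ r := by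
      have := (Finset.card_lt_iff_ne_univ S).mpr hne
      rw [Fintype.card_fin] at this
      omega
    obtain ⟨w, hw, rfl⟩ := exists_word hS hcard
    rw [← raiseDualWord_sumLowerSumPow hν hw hS ψ hψ', hψ]
    exact map_zero _
  have hconst : ∀ L : Finset (Fin (r + 1)), L.Nonempty → ψ' L = ψ' Finset.univ := by
    intro L hL
    rw [← sum_superset_sum_superset ψ' L, Finset.sum_eq_single Finset.univ]
    · simp [Finset.univ_subset_iff, Finset.filter_eq']
    · intro S hS hne
      exact hzero S (hL.mono (Finset.mem_filter.mp hS).2) hne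
    · simp
  have hmem : ∀ L : Finset (Fin (r + 1)), L.Nonempty →
      ψ' Finset.univ ∈ linFormAnnihilator L (ν 0) := by
    intro L hL
    rw [← hconst L hL, hψ' ⟨L, hL⟩]
    exact (ψ ⟨L, hL⟩).2
  have huniv : ψ' Finset.univ = 0 := by
    refine eq_zero_of_forall_X_mul
      (mem_linFormAnnihilator.mp (hmem _ Finset.univ_nonempty)).1 h0 fun j f => ?_
    have := (mem_linFormAnnihilator.mp (hmem {j} (Finset.singleton_nonempty j))).2 f
    rwa [linForm, Finset.sum_singleton] at this
  refine funext fun L => Subtype.ext ?_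
  rw [← hψ', hconst _ L.2, huniv]
  rfl

lemma sumLowerSumPow_surjective (hr : 1 ≤ r) (hν : IsTower r r ν) :
    Function.Surjective (sumLowerSumPow hν) := by
  classical
  rintro ⟨φ, hφ⟩
  set Φ : Finset (Fin (r + 1)) → Module.Dual (ZMod 2) (F2Poly (r + 1)) := fun S =>
    if h : ∃ w : List (Fin (r + 1)), w.length = r ∧ w.toFinset = S then
      raiseDualWord h.choose φ else 0 with hΦdef
  have hΦw : ∀ w : List (Fin (r + 1)), w.length = r → Φ w.toFinset = raiseDualWord w φ := by
    intro w hw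
    have h : ∃ w' : List (Fin (r + 1)), w'.length = r ∧ w'.toFinset = w.toFinset := ⟨w, hw, rfl⟩
    have hspec := h.choose_spec
    rw [hΦdef]
    simp only [dif_pos h]
    exact hν.raiseDualWord_eq_of_toFinset_eq (hspec.1.trans hw.symm) hspec.2 hspec.1.le
      (hspec.1.symm ▸ hφ)
  have hΦmem : ∀ S, Φ S ∈ hitAnnihilator (r + 1) (ν 0) := by
    intro S
    by_cases h : ∃ w : List (Fin (r + 1)), w.length = r ∧ w.toFinset = S
    · obtain ⟨w, hw, rfl⟩ := h
      rw [hΦw w hw]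
      refine hν.raiseDualWord_mem w (by omega) ?_
      rwa [zero_add, hw]
    · rw [hΦdef]
      simp only [dif_neg h]
      exact zero_mem _
  have hΦuniv : Φ Finset.univ = 0 := by
    refine dif_neg ?_
    rintro ⟨w, hw, hu⟩
    have := w.toFinset_card_le
    rw [hu, Finset.card_fin] at this
    omega
  have hΦsum : ∀ S : Finset (Fin (r + 1)), S.card < r →
      ∀ z, ∑ j, Φ (insert j S) (X j * z) = 0 := by
    intro S hS z
    rcases S.eq_empty_or_nonempty with rfl | hne
    · have h := hν.sum_raiseDualWord_replicate_X_mul (t := 0) (r - 1) (by omega)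
        (φ := φ) (by rwa [show 0 + (r - 1) + 1 = r by omega]) z
      rw [← h]
      refine Finset.sum_congr rfl fun j _ => ?_
      rw [← hΦw _ (by rw [List.length_replicate]; omega),
        List.toFinset_replicate_of_ne_zero (by omega)]
      rfl
    · obtain ⟨w, hw, rfl⟩ := exists_word hne (Nat.le_sub_one_of_lt hS)
      have hmem := hν.raiseDualWord_mem w (t := 1) (by omega) (φ := φ)
        (by rwa [show 1 + w.length = r by omega])
      rw [← hν.sum_raiseDual_X_mul (t := 0) (by omega) hmem z]
      refine Finset.sum_congr rfl fun j _ => ?_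
      have h := hΦw (w ++ [j]) (by rw [List.length_append, hw, List.length_singleton]; omega)
      rw [raiseDualWord_append, List.toFinset_append, List.toFinset_cons, List.toFinset_nil,
        insert_empty_eq, Finset.union_comm, ← Finset.insert_eq] at h
      rw [h]
      rfl
  obtain ⟨ψ, hψmem, hψsum⟩ := exists_linFormAnnihilator_sum_eq hΦmem hΦuniv hΦsum
  refine ⟨fun L => ⟨ψ L.1, hψmem L.1⟩, Subtype.ext ?_⟩
  rw [← sub_eq_zero]
  refine hν.eq_zero_of_raiseDualWord le_rfl (sub_mem (Subtype.prop _) hφ) fun w hw => ?_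
  have hne : w.toFinset.Nonempty := by
    rw [List.toFinset_nonempty_iff, ← List.length_pos_iff]
    omega
  rw [map_sub, raiseDualWord_sumLowerSumPow hν hw hne _ (ψ' := ψ) fun _ => rfl,
    hψsum _ (w.toFinset_card_le.trans hw.le), hΦw w hw, sub_self]

end Decomposition

section Elimination

variable {r n : ℕ} {L : Finset (Fin (r + 1))} {p : Fin (r + 1)}

/-- The substitution eliminating `x_p` through the relation `linForm L = 0`, for `p ∈ L`. -/
noncomputable def eliminate (L : Finset (Fin (r + 1))) (p : Fin (r + 1)) :
    F2Poly (r + 1) →ₐ[ZMod 2] F2Poly r :=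
  aeval (Fin.insertNth (α := fun _ => F2Poly r) p
    (linForm (Finset.univ.filter fun j => p.succAbove j ∈ L)) X)

lemma eliminate_X_same :
    eliminate L p (X p) = linForm (Finset.univ.filter fun j => p.succAbove j ∈ L) := by
  simp [eliminate]

lemma eliminate_X_succAbove (j : Fin r) : eliminate L p (X (p.succAbove j)) = X j := by
  simp [eliminate]

lemma algHom_ext_succAbove {A : Type*} [CommSemiring A] [Algebra (ZMod 2) A]
    {f g : F2Poly (r + 1) →ₐ[ZMod 2] A} (p : Fin (r + 1)) (hp : f (X p) = g (X p))
    (h : ∀ j, f (X (p.succAbove j)) = g (X (p.succAbove j))) : f = g := by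
  refine algHom_ext fun i => ?_
  rcases Fin.eq_self_or_eq_succAbove p i with rfl | ⟨j, rfl⟩
  exacts [hp, h j]

lemma SqTotal_linForm {k : ℕ} (L : Finset (Fin k)) :
    SqTotal k (linForm L) = linForm L + linForm L ^ 2 := by
  simp only [linForm, map_sum, SqTotal_X, Finset.sum_add_distrib, sum_pow_char]

lemma eliminate_SqTotal (f : F2Poly (r + 1)) :
    eliminate L p (SqTotal _ f) = SqTotal _ (eliminate L p f) := by
  have : (eliminate L p).comp (SqTotal _) = (SqTotal _).comp (eliminate L p) := by
    refine algHom_ext_succAbove p ?_ fun j => ?_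
    · simp [eliminate_X_same, SqTotal_linForm]
    · simp [eliminate_X_succAbove]
  exact DFunLike.congr_fun this f

lemma rename_SqTotal {k l : ℕ} (ι : Fin k → Fin l) (f : F2Poly k) :
    rename ι (SqTotal _ f) = SqTotal _ (rename ι f) := by
  have : (rename ι).comp (SqTotal _) = (SqTotal _).comp (rename ι) :=
    algHom_ext fun i => by simp
  exact DFunLike.congr_fun this f

lemma eliminate_rename (f : F2Poly r) : eliminate L p (rename p.succAbove f) = f := by
  have : (eliminate L p).comp (rename p.succAbove) = AlgHom.id (ZMod 2) _ :=
    algHom_ext fun i => by simp [eliminate_X_succAbove]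
  exact DFunLike.congr_fun this f

lemma linForm_eq_X_add (hp : p ∈ L) :
    linForm L =
      X p + rename p.succAbove (linForm (Finset.univ.filter fun j => p.succAbove j ∈ L)) := by
  have h : linForm L = ∑ j, if j ∈ L then X j else 0 := by simp [linForm]
  rw [h, Fin.sum_univ_succAbove _ p, if_pos hp]
  simp [linForm, Finset.sum_filter, apply_ite (rename p.succAbove)]

lemma eliminate_linForm (hp : p ∈ L) : eliminate L p (linForm L) = 0 := by
  rw [linForm_eq_X_add hp, map_add, eliminate_rename, eliminate_X_same,
    CharTwo.add_self_eq_zero]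

lemma exists_rename_eliminate_eq_add (hp : p ∈ L) (f : F2Poly (r + 1)) :
    ∃ g, rename p.succAbove (eliminate L p f) = f + linForm L * g := by
  set q := Ideal.Quotient.mkₐ (ZMod 2) (Ideal.span {linForm L})
  have : q.comp ((rename p.succAbove).comp (eliminate L p)) = q := by
    refine algHom_ext_succAbove p ?_ fun j => ?_
    · simp only [AlgHom.comp_apply, eliminate_X_same]
      refine (Ideal.Quotient.mk_eq_mk_iff_sub_mem _ _).mpr ?_
      have h := Ideal.mem_span_singleton_self (linForm L)
      rwa [CharTwo.sub_eq_add, add_comm _ (X p), ← linForm_eq_X_add hp]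
    · simp [eliminate_X_succAbove]
  have h := (Ideal.Quotient.mk_eq_mk_iff_sub_mem _ _).mp (DFunLike.congr_fun this f)
  obtain ⟨g, hg⟩ := Ideal.mem_span_singleton.mp h
  exact ⟨g, by rw [← hg]; simp⟩

lemma linForm_isHomogeneous {k : ℕ} (L : Finset (Fin k)) : (linForm L).IsHomogeneous 1 :=
  IsHomogeneous.sum _ _ _ fun j _ => isHomogeneous_X _ j

lemma eliminate_monomial_degreesIn (e : Fin (r + 1) →₀ ℕ) :
    DegreesIn {e.degree} (eliminate L p (monomial e 1)) := by
  refine DegreesIn.of_isHomogeneous ?_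
  rw [← one_mul e.degree]
  refine (isHomogeneous_monomial 1 rfl).aeval _ fun i => ?_
  rcases Fin.eq_self_or_eq_succAbove p i with rfl | ⟨j, rfl⟩
  · rw [Fin.insertNth_apply_same]
    exact linForm_isHomogeneous _
  · rw [Fin.insertNth_apply_succAbove]
    exact isHomogeneous_X _ j

/-- Functionals vanishing on the multiples of a nonzero linear form are functionals in one
variable fewer. -/
noncomputable def linFormAnnihilatorEquiv (hp : p ∈ L) :
    linFormAnnihilator L n ≃ₗ[ZMod 2] hitAnnihilator r n where
  toFun ψ := ⟨ψ.1 ∘ₗ (rename p.succAbove).toLinearMap, by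
    obtain ⟨hψ, -⟩ := mem_linFormAnnihilator.mp ψ.2
    refine ⟨LinearMap.ext fun f => ?_, fun e he => ?_⟩
    · simp [rename_SqTotal, apply_SqTotal hψ]
    · have h : DegreesIn {e.degree} (rename p.succAbove (monomial e (1 : ZMod 2))) :=
        DegreesIn.of_isHomogeneous (isHomogeneous_monomial 1 rfl).rename_isHomogeneous
      exact apply_eq_zero_of_degreesIn hψ.2 h he.symm⟩
  invFun χ := ⟨χ.1 ∘ₗ (eliminate L p).toLinearMap, by
    refine mem_linFormAnnihilator.mpr
      ⟨⟨LinearMap.ext fun f => ?_, fun e he => ?_⟩, fun f => ?_⟩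
    · simp [eliminate_SqTotal, apply_SqTotal χ.2]
    · exact apply_eq_zero_of_degreesIn χ.2.2 (eliminate_monomial_degreesIn e) he.symm
    · simp [eliminate_linForm hp]⟩
  map_add' _ _ := rfl
  map_smul' _ _ := rfl
  left_inv ψ := by
    refine Subtype.ext (LinearMap.ext fun f => ?_)
    obtain ⟨g, hg⟩ := exists_rename_eliminate_eq_add hp f
    simp [hg, (mem_linFormAnnihilator.mp ψ.2).2]
  right_inv χ := by
    refine Subtype.ext (LinearMap.ext fun f => ?_)
    simp [eliminate_rename]

end Elimination

section Duality

variable {k n : ℕ}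

lemma apply_homogeneousComponent {φ : Module.Dual (ZMod 2) (F2Poly k)}
    (hφ : φ ∈ hitAnnihilator k n) (m : ℕ) (f : F2Poly k) :
    φ (homogeneousComponent m f) = if m = n then φ f else 0 := by
  split_ifs with h
  · subst h
    rw [← sub_eq_zero, ← map_sub]
    refine apply_eq_zero_of_degreesIn hφ.2 (A := {m}ᶜ) (fun e he => ?_) (by simp)
    rw [coeff_sub, coeff_homogeneousComponent] at he
    intro h
    simp_all
  · exact apply_eq_zero_of_degreesIn hφ.2
      (DegreesIn.of_isHomogeneous (homogeneousComponent_isHomogeneous m f)) (Ne.symm h)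

lemma apply_eq_zero_of_mem_hitSubmodule {φ : Module.Dual (ZMod 2) (F2Poly k)}
    (hφ : φ ∈ hitAnnihilator k n) {f : F2Poly k} (hf : f ∈ hitSubmodule k) : φ f = 0 := by
  have : hitSubmodule k ≤ LinearMap.ker φ := by
    refine Submodule.span_le.mpr ?_
    rintro _ ⟨i, f, hi, rfl⟩
    refine LinearMap.mem_ker.mpr ?_
    rw [SqOp, map_sum]
    refine Finset.sum_eq_zero fun d _ => ?_
    rw [apply_homogeneousComponent hφ, apply_SqTotal hφ, apply_homogeneousComponent hφ]
    split_ifs <;> first | omega | rfl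
  exact this hf

lemma SqOp_of_isHomogeneous {i m : ℕ} {f : F2Poly k} (hf : f.IsHomogeneous m) :
    SqOp k i f = homogeneousComponent (m + i) (SqTotal k f) := by
  by_cases h0 : f = 0
  · simp [h0, SqOp]
  rw [SqOp, Finset.sum_eq_single m]
  · rw [homogeneousComponent_of_mem hf, if_pos rfl]
  · intro d _ hd
    rw [homogeneousComponent_of_mem hf, if_neg hd, map_zero, map_zero]
  · rw [hf.totalDegree h0]
    simp

lemma homogeneousComponent_eq_zero_of_degreesIn {A : Set ℕ} {f : F2Poly k}
    (hf : DegreesIn A f) (hn : n ∉ A) : homogeneousComponent n f = 0 :=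
  homogeneousComponent_eq_zero' _ _ fun e he h =>
    hn (h ▸ hf e (mem_support_iff.mp he))

/-- The projection of `P_k` onto `(QP_k)_n`. -/
noncomputable def toQP (k n : ℕ) : F2Poly k →ₗ[ZMod 2] QP k n :=
  Submodule.mkQ _ ∘ₗ
    (homogeneousComponent n).codRestrict (homogeneousSubmodule (Fin k) (ZMod 2) n)
      fun f => homogeneousComponent_mem n f

lemma toQP_congr {f g : F2Poly k} (h : homogeneousComponent n f = homogeneousComponent n g) :
    toQP k n f = toQP k n g :=
  congrArg (Submodule.mkQ _) (Subtype.ext h)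

lemma toQP_coe (x : homogeneousSubmodule (Fin k) (ZMod 2) n) :
    toQP k n x = Submodule.mkQ _ x :=
  congrArg (Submodule.mkQ _) (Subtype.ext (homogeneousComponent_eq_self x.2))

lemma toQP_eq_zero {f : F2Poly k} (h : homogeneousComponent n f ∈ hitSubmodule k) :
    toQP k n f = 0 :=
  (Submodule.Quotient.mk_eq_zero _).mpr h

lemma toQP_SqTotal_monomial (e : Fin k →₀ ℕ) :
    toQP k n (SqTotal k (monomial e 1)) = toQP k n (monomial e 1) := by
  rcases le_or_gt n e.degree with h | h
  · refine toQP_congr ?_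
    rw [← sub_eq_zero, ← map_sub]
    exact homogeneousComponent_eq_zero_of_degreesIn (SqTotal_monomial_degreesIn e).1 h.not_gt
  · rw [toQP_eq_zero, toQP_eq_zero]
    · rw [homogeneousComponent_eq_zero_of_degreesIn (DegreesIn.monomial e) h.ne']
      exact zero_mem _
    · refine Submodule.subset_span ⟨n - e.degree, monomial e 1, Nat.sub_pos_of_lt h, ?_⟩
      rw [SqOp_of_isHomogeneous (isHomogeneous_monomial 1 rfl), Nat.add_sub_of_le h.le]

/-- The dual of `(QP_k)_n`. -/
noncomputable def hitAnnihilatorEquivDual (k n : ℕ) :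
    hitAnnihilator k n ≃ₗ[ZMod 2] Module.Dual (ZMod 2) (QP k n) where
  toFun φ := Submodule.liftQ _ (φ.1 ∘ₗ Submodule.subtype _) fun _ hx =>
    apply_eq_zero_of_mem_hitSubmodule φ.2 hx
  invFun χ := ⟨χ ∘ₗ toQP k n, by
    refine ⟨linearMap_ext_monomial fun e => ?_, fun e he => ?_⟩
    · exact congrArg χ (toQP_SqTotal_monomial e)
    · have h := homogeneousComponent_eq_zero_of_degreesIn (DegreesIn.monomial e) he.symm
      rw [LinearMap.comp_apply, toQP_eq_zero, map_zero]
      exact h ▸ zero_mem _⟩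
  map_add' _ _ := Submodule.linearMap_qext _ rfl
  map_smul' _ _ := Submodule.linearMap_qext _ rfl
  left_inv φ := by
    refine Subtype.ext (LinearMap.ext fun f => ?_)
    exact (apply_homogeneousComponent φ.2 n f).trans (if_pos rfl)
  right_inv χ := by
    refine Submodule.linearMap_qext _ (LinearMap.ext fun x => ?_)
    exact congrArg χ (toQP_coe x)

lemma finrank_QP (k n : ℕ) :
    Module.finrank (ZMod 2) (QP k n) = Module.finrank (ZMod 2) (hitAnnihilator k n) := by
  rw [(hitAnnihilatorEquivDual k n).finrank_eq, Subspace.dual_finrank_eq]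

instance finite_hitAnnihilator (k n : ℕ) : Module.Finite (ZMod 2) (hitAnnihilator k n) := by
  have : Finite {e : Fin k →₀ ℕ // e.degree ≤ n} :=
    (Finsupp.finite_of_degree_le (σ := Fin k) n).to_subtype
  let ev : hitAnnihilator k n →ₗ[ZMod 2] ({e : Fin k →₀ ℕ // e.degree ≤ n} → ZMod 2) :=
    LinearMap.pi (fun e => LinearMap.applyₗ (monomial e.1 1)) ∘ₗ Submodule.subtype _
  refine Module.Finite.of_injective ev fun φ ψ h =>
    Subtype.ext (linearMap_ext_monomial fun e => ?_)
  by_cases he : e.degree = n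
  · exact congrFun h ⟨e, he.le⟩
  · rw [φ.2.2 e he, ψ.2.2 e he]

end Duality

section DegreeSum

/-- The degree `∑ i ∈ [1, r], (2 ^ (d i - t) - 1)`. -/
def degreeSum (r : ℕ) (d : ℕ → ℕ) (t : ℕ) : ℕ := ∑ i ∈ Finset.Icc 1 r, (2 ^ (d i - t) - 1)

variable {r s t : ℕ} {d : ℕ → ℕ}

lemma degreeSum_eq_two_mul_add (h : ∀ i ∈ Finset.Icc 1 r, t < d i) :
    degreeSum r d t = 2 * degreeSum r d (t + 1) + r := by
  have : ∀ i ∈ Finset.Icc 1 r, 2 ^ (d i - t) - 1 = 2 * (2 ^ (d i - (t + 1)) - 1) + 1 := by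
    intro i hi
    have h1 : d i - t = d i - (t + 1) + 1 := by have := h i hi; omega
    have h2 := Nat.one_le_two_pow (n := d i - (t + 1))
    rw [h1, pow_succ]
    omega
  rw [degreeSum, Finset.sum_congr rfl this, Finset.sum_add_distrib, ← Finset.mul_sum, degreeSum]
  simp

lemma isRegularDegree_degreeSum {k : ℕ} (hk : k ≤ s + 2)
    (hinj : Set.InjOn d (Finset.Icc 1 s)) (hle : ∀ i ∈ Finset.Icc 1 s, d (s + 1) ≤ d i)
    (ht : t < d (s + 1)) : IsRegularDegree k (s + 1) (degreeSum (s + 1) d t) := by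
  intro φ hφ J hJ y
  refine LinearMap.congr_fun (comp_raise_eq_zero hφ fun a => ?_) y
  have hJk : J.card ≤ k := by simpa using Finset.card_le_univ J
  rcases Nat.lt_or_ge J.card (s + 1) with h | h
  · refine sum_two_pow_sub_one_add_ne (c := fun i => d i - t) (fun i hi j hj hij => ?_)
      (fun i hi => Nat.sub_le_sub_right (hle i hi) t) (by omega) (by omega) rfl _
    have h1 := hle i hi
    have h2 := hle j hj
    exact hinj hi hj (by simp only at hij; omega)
  · have h2 : ∀ i ∈ Finset.Icc 1 (s + 1), t < d i := by
      intro i hi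
      rcases eq_or_ne i (s + 1) with rfl | hne
      · exact ht
      · have := Finset.mem_Icc.mp hi
        exact ht.trans_le (hle i (Finset.mem_Icc.mpr (by omega)))
    rw [degreeSum_eq_two_mul_add h2]
    have h3 : ∑ j ∈ J, 2 ^ (a j + 1) = 2 * ∑ j ∈ J, 2 ^ a j := by
      rw [Finset.mul_sum]
      exact Finset.sum_congr rfl fun j _ => pow_succ' _ _
    omega

end DegreeSum

section Dimension

lemma finrank_hitAnnihilator_succ {r : ℕ} {ν : ℕ → ℕ} (hr : 1 ≤ r) (hν : IsTower r r ν)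
    (h0 : ν 0 ≠ 0) :
    Module.finrank (ZMod 2) (hitAnnihilator (r + 1) (ν r)) =
      (2 ^ (r + 1) - 1) * Module.finrank (ZMod 2) (hitAnnihilator r (ν 0)) := by
  have hequiv (L : {L : Finset (Fin (r + 1)) // L.Nonempty}) :
      Nonempty (linFormAnnihilator L.1 (ν 0) ≃ₗ[ZMod 2] hitAnnihilator r (ν 0)) :=
    ⟨linFormAnnihilatorEquiv L.2.choose_spec⟩
  have hcard : Fintype.card {L : Finset (Fin (r + 1)) // L.Nonempty} = 2 ^ (r + 1) - 1 := by
    have h := Fintype.card_subtype_compl fun L : Finset (Fin (r + 1)) => L = ∅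
    simp only [Fintype.card_subtype_eq, Fintype.card_finset, Fintype.card_fin] at h
    rw [← h]
    exact Fintype.card_congr
      (Equiv.subtypeEquivRight fun L => Finset.nonempty_iff_ne_empty)
  have hfin (L : {L : Finset (Fin (r + 1)) // L.Nonempty}) :
      Module.Finite (ZMod 2) (linFormAnnihilator L.1 (ν 0)) :=
    Module.Finite.equiv (hequiv L).some.symm
  have hfree (L : {L : Finset (Fin (r + 1)) // L.Nonempty}) :
      Module.Free (ZMod 2) (linFormAnnihilator L.1 (ν 0)) := inferInstance
  rw [← (LinearEquiv.ofBijective _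
    ⟨sumLowerSumPow_injective hν h0, sumLowerSumPow_surjective hr hν⟩).finrank_eq,
    Module.finrank_pi_fintype, Finset.sum_congr rfl fun L _ => (hequiv L).some.finrank_eq,
    Finset.sum_const, Finset.card_univ, hcard, smul_eq_mul]

lemma finrank_hitAnnihilator_degreeSum {s : ℕ} {d : ℕ → ℕ}
    (hinj : Set.InjOn d (Finset.Icc 1 s)) (hle : ∀ i ∈ Finset.Icc 1 s, d (s + 1) ≤ d i)
    (hlt : s + 1 < d 1) (hge : s + 1 ≤ d (s + 1)) :
    Module.finrank (ZMod 2) (hitAnnihilator (s + 2) (degreeSum (s + 1) d 0)) =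
      (2 ^ (s + 2) - 1) *
        Module.finrank (ZMod 2) (hitAnnihilator (s + 1) (degreeSum (s + 1) d (d (s + 1)))) := by
  have hle' : ∀ i ∈ Finset.Icc 1 (s + 1), d (s + 1) ≤ d i := by
    intro i hi
    rcases eq_or_ne i (s + 1) with rfl | hne
    · exact le_rfl
    · have := Finset.mem_Icc.mp hi
      exact hle i (Finset.mem_Icc.mpr (by omega))
  have hstep : ∀ t < d (s + 1),
      degreeSum (s + 1) d t = 2 * degreeSum (s + 1) d (t + 1) + (s + 1) :=
    fun t ht => degreeSum_eq_two_mul_add fun i hi => ht.trans_le (hle' i hi)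
  have htower : IsTower (s + 1) (s + 1) fun t => degreeSum (s + 1) d (s + 1 - t) := by
    refine ⟨fun t ht => ?_, fun t ht => ?_⟩
    · have h : s + 1 - t = s + 1 - (t + 1) + 1 := by omega
      rw [h]
      exact hstep _ (by omega)
    · exact isRegularDegree_degreeSum le_rfl hinj hle (by omega)
  have hne : degreeSum (s + 1) d (s + 1) ≠ 0 := by
    intro h
    have h1 := Finset.sum_eq_zero_iff.mp h 1 (by simp)
    have h2 : 1 < 2 ^ (d 1 - (s + 1)) := Nat.one_lt_two_pow (by omega)
    omega
  have hkameko : ∀ t ≤ d (s + 1), s + 1 ≤ t →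
      Module.finrank (ZMod 2) (hitAnnihilator (s + 1) (degreeSum (s + 1) d (s + 1))) =
        Module.finrank (ZMod 2) (hitAnnihilator (s + 1) (degreeSum (s + 1) d t)) := by
    intro t ht hst
    induction t, hst using Nat.le_induction with
    | base => rfl
    | succ t _ ih =>
      have hreg := isRegularDegree_degreeSum (k := s + 1) (by omega) hinj hle (t := t) ht
      rw [ih (by omega)]
      rw [hstep t ht] at hreg ⊢
      exact (kamekoEquiv hreg).finrank_eq
  have h := finrank_hitAnnihilator_succ (by omega) htower (by simpa using hne)
  beta_reduce at h
  rwa [Nat.sub_self, Nat.sub_zero, hkameko _ le_rfl hge] at h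

end Dimension

/-- Theorem 1.3: for `k ≥ 4` and positive integers `d_1 > d_2 > … > d_{k-2} ≥ d_{k-1}`
with `d_{k-1} ≥ k - 1`, setting `n = Σ_{i=1}^{k-1} (2^{d_i} - 1)` and
`m = Σ_{i=1}^{k-2} (2^{d_i - d_{k-1}} - 1)`, one has
`dim (QP_k)_n = (2^k - 1) · dim (QP_{k-1})_m`. -/
theorem stmt5 (k : ℕ) (hk : 4 ≤ k) (d : ℕ → ℕ)
    (hpos : ∀ i, 1 ≤ i → i ≤ k - 1 → 0 < d i)
    (hstrict : ∀ i, 2 ≤ i → i ≤ k - 2 → d i < d (i - 1))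
    (hweak : d (k - 1) ≤ d (k - 2))
    (hge : k - 1 ≤ d (k - 1)) :
    Module.finrank (ZMod 2) (QP k (∑ i ∈ Finset.Icc 1 (k - 1), (2 ^ d i - 1))) =
      (2 ^ k - 1) *
        Module.finrank (ZMod 2)
          (QP (k - 1) (∑ i ∈ Finset.Icc 1 (k - 2), (2 ^ (d i - d (k - 1)) - 1))) := by
  obtain ⟨s, rfl⟩ : ∃ s, k = s + 2 := ⟨k - 2, by omega⟩
  simp only [Nat.add_sub_cancel, show s + 2 - 1 = s + 1 from rfl] at *
  have hanti : StrictAntiOn d (Set.Icc 1 s) := by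
    refine strictAntiOn_of_succ_lt Set.ordConnected_Icc fun a _ ha ha' => ?_
    have := hstrict (a + 1) (by simpa using ha.1) ha'.2
    simpa using this
  have hle : ∀ i ∈ Finset.Icc 1 s, d (s + 1) ≤ d i := by
    intro i hi
    have hi := Finset.mem_Icc.mp hi
    exact hweak.trans (hanti.antitoneOn hi ⟨by omega, le_rfl⟩ hi.2)
  have hlt : s + 1 < d 1 :=
    hge.trans_lt (hweak.trans_lt (hanti ⟨le_rfl, by omega⟩ ⟨by omega, le_rfl⟩ (by omega)))
  have hm : degreeSum (s + 1) d (d (s + 1)) =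
      ∑ i ∈ Finset.Icc 1 s, (2 ^ (d i - d (s + 1)) - 1) := by
    rw [degreeSum, Finset.sum_Icc_succ_top (by omega)]
    simp
  have h := finrank_hitAnnihilator_degreeSum (by simpa using hanti.injOn) hle hlt hge
  rw [hm] at h
  rw [finrank_QP, finrank_QP]
  exact h
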